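/- arXiv:math/0610654 — 3 statements merged into one kernel-verified Lean document; each statement's English description precedes it below -/
import Mathlib

section
/- Suppose X_V is a stationary process satisfying condition (P). Let t∈ℤ, let S(t)={X_v(s) : v∈V, s≤t} be the family of past and present variables, and let Y₁ and Y₂ be finite disjoint subsets of S(t). Then Y₁ and Y₂ are measurably separated conditionally on the σ-algebra 𝒢 generated by S(t)∖(Y₁∪Y₂); that is, (σ(Y₁)∨𝒢)∩(σ(Y₂)∨𝒢)=𝒢, where all σ-algebras are P-completed. -/
open MeasureTheory ProbabilityTheory Filter

noncomputable section

namespace GraphicalTS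

/-! ### Mixed graphs, paths and p-separation -/

/-- A mixed graph on vertex type `V`, with directed edges `dir a b` (i.e. `a → b`)
and (symmetric) undirected edges `undir a b` (i.e. `a — b`). -/
structure MixedGraph (V : Type*) where
  dir : V → V → Prop
  undir : V → V → Prop
  undir_symm : ∀ a b, undir a b → undir b a

namespace MixedGraph

variable {V : Type*}

/-- Parents of a set `A`: vertices `v ∉ A` with `v → a` for some `a ∈ A`. -/
def pa (G : MixedGraph V) (A : Set V) : Set V := {v | ∃ a ∈ A, G.dir v a} \ A

/-- Neighbours of a set `A`: vertices `v ∉ A` with `v — a` for some `a ∈ A`. -/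
def nb (G : MixedGraph V) (A : Set V) : Set V := {v | ∃ a ∈ A, G.undir v a} \ A

/-- Children of a set `A`: vertices `v ∉ A` with `a → v` for some `a ∈ A`. -/
def ch (G : MixedGraph V) (A : Set V) : Set V := {v | ∃ a ∈ A, G.dir a v} \ A

/-- `b` is an ancestor of `a`: `b = a` or there is a directed path `b → ⋯ → a`. -/
def ancestor (G : MixedGraph V) (b a : V) : Prop := Relation.ReflTransGen G.dir b a

/-- The set of ancestors of elements of `A`. -/
def anc (G : MixedGraph V) (A : Set V) : Set V := {b | ∃ a ∈ A, G.ancestor b a}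

end MixedGraph

/-- The orientation of an edge as traversed along a path: forward directed (tail at the
current vertex, arrowhead at the next), backward directed, or undirected. -/
inductive EdgeKind : Type
  | fwd | bwd | un

/-- A path between `a` and `b` in the mixed graph `G`: a sequence of `n` edges along
vertices `vert 0 = a, vert 1, …, vert n = b`; vertices and edges may repeat.
(`vert` and `kind` are total functions on `ℕ`; only the values `vert 0,…,vert n` and
`kind 0,…,kind (n-1)` are constrained.) -/
structure MGPath {V : Type*} (G : MixedGraph V) (a b : V) where
  n : ℕ
  vert : ℕ → V
  kind : ℕ → EdgeKind
  src : vert 0 = a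
  tgt : vert n = b
  valid : ∀ i, i < n →
    (kind i = EdgeKind.fwd → G.dir (vert i) (vert (i + 1))) ∧
    (kind i = EdgeKind.bwd → G.dir (vert (i + 1)) (vert i)) ∧
    (kind i = EdgeKind.un → G.undir (vert i) (vert (i + 1)))

namespace MGPath

variable {V : Type*} {G : MixedGraph V} {a b : V}

/-- The intermediate vertex at position `j` (for `0 < j < n`) is a p-collider: the two
adjacent edges form `→ c ←`, `→ c —` or `— c ←`. -/
def colliderAt (p : MGPath G a b) (j : ℕ) : Prop :=
  p.kind (j - 1) ≠ EdgeKind.bwd ∧ p.kind j ≠ EdgeKind.fwd ∧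
    ¬(p.kind (j - 1) = EdgeKind.un ∧ p.kind j = EdgeKind.un)

/-- The path is p-connecting given `S`: every intermediate p-noncollider is outside `S`
and every intermediate p-collider is in `S`. -/
def pConnecting (p : MGPath G a b) (S : Set V) : Prop :=
  ∀ j, 0 < j → j < p.n →
    (p.colliderAt j → p.vert j ∈ S) ∧ (¬p.colliderAt j → p.vert j ∉ S)

/-- The path has an arrowhead at its endpoint `b`. -/
def bPointing (p : MGPath G a b) : Prop :=
  0 < p.n ∧ p.kind (p.n - 1) = EdgeKind.fwd

/-- The path has arrowheads at both endpoints. -/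
def biPointing (p : MGPath G a b) : Prop :=
  0 < p.n ∧ p.kind 0 = EdgeKind.bwd ∧ p.kind (p.n - 1) = EdgeKind.fwd

/-- The path consists of undirected edges only. -/
def undirected (p : MGPath G a b) : Prop := ∀ i, i < p.n → p.kind i = EdgeKind.un

/-- The path is a composition of finitely many subpaths, each of which is undirected
or bi-pointing (cut points `c 0 = 0 < c 1 < ⋯ < c m = n`). -/
def extBiPointing (p : MGPath G a b) : Prop :=
  ∃ (m : ℕ) (c : ℕ → ℕ), c 0 = 0 ∧ c m = p.n ∧ (∀ k, k < m → c k < c (k + 1)) ∧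
    ∀ k, k < m →
      (∀ i, c k ≤ i → i < c (k + 1) → p.kind i = EdgeKind.un) ∨
      (p.kind (c k) = EdgeKind.bwd ∧ p.kind (c (k + 1) - 1) = EdgeKind.fwd)

/-- Every intermediate vertex on the path is a p-collider. -/
def pureCollider (p : MGPath G a b) : Prop := ∀ j, 0 < j → j < p.n → p.colliderAt j

/-- The path is a trail: all intermediate vertices are distinct. -/
def isTrail (p : MGPath G a b) : Prop :=
  ∀ i j, 0 < i → i < p.n → 0 < j → j < p.n → p.vert i = p.vert j → i = j

/-- The trail is p-active relative to `S` (Andersson–Madigan–Perlman): every p-collider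
lies in `an(S)`, and every p-noncollider `v` either lies outside `S`, or its two adjacent
edges are undirected and `pa(v) ∖ S ≠ ∅`. -/
def pActive (p : MGPath G a b) (S : Set V) : Prop :=
  ∀ j, 0 < j → j < p.n →
    (p.colliderAt j → p.vert j ∈ G.anc S) ∧
    (¬p.colliderAt j →
      p.vert j ∉ S ∨
        (p.kind (j - 1) = EdgeKind.un ∧ p.kind j = EdgeKind.un ∧
          ({v | G.dir v (p.vert j)} \ S).Nonempty))

end MGPath

/-- `A` and `B` are p-separated given `S`: every path between a vertex of `A` and a
vertex of `B` is p-blocked given `S`. -/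
def pSeparated {V : Type*} (G : MixedGraph V) (A B S : Set V) : Prop :=
  ∀ a ∈ A, ∀ b ∈ B, ∀ p : MGPath G a b, ¬p.pConnecting S

/-- `a` and `b` are joined in `G` by an undirected path none of whose intermediate
vertices lies in `an(W) ∖ {a, b}`. -/
def undirAvoiding {V : Type*} (G : MixedGraph V) (W : Set V) (a b : V) : Prop :=
  ∃ p : MGPath G a b, 0 < p.n ∧ p.undirected ∧
    ∀ j, 0 < j → j < p.n → p.vert j ∉ G.anc W \ {a, b}

/-- The marginal ancestral graph `G_[A]` (for an ancestral set `A`): the subgraph of `G`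
induced by `A`, together with an additional undirected edge `a — b` for each pair
`a, b ∈ A` joined in `G` by an undirected path avoiding `an(A) ∖ {a, b}`. -/
def marginalGraph {V : Type*} (G : MixedGraph V) (A : Set V) : MixedGraph V where
  dir u v := G.dir u v ∧ u ∈ A ∧ v ∈ A
  undir u v := (G.undir u v ∧ u ∈ A ∧ v ∈ A) ∨
    (u ∈ A ∧ v ∈ A ∧ (undirAvoiding G A u v ∨ undirAvoiding G A v u))
  undir_symm := by
    rintro x y (⟨h, hx, hy⟩ | ⟨hx, hy, h⟩)
    · exact Or.inl ⟨G.undir_symm _ _ h, hy, hx⟩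
    · exact Or.inr ⟨hy, hx, h.symm⟩

/-! ### σ-algebras, conditional independence, Granger causality -/

variable {Ω : Type*}

/-- The `μ`-completion of a sub-σ-algebra `m`: the σ-algebra generated by `m` together
with all `μ`-null sets. -/
def mComplete [MeasurableSpace Ω] (μ : Measure Ω) (m : MeasurableSpace Ω) :
    MeasurableSpace Ω :=
  m ⊔ MeasurableSpace.generateFrom {s : Set Ω | μ s = 0}

/-- `ℱ_A(t)`: the `μ`-completed σ-algebra generated by `{X_a(s) : a ∈ A, s ≤ t}`. -/
def pastSigma {V : Type*} [MeasurableSpace Ω] (μ : Measure Ω) (X : V → ℤ → Ω → ℝ)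
    (A : Set V) (t : ℤ) : MeasurableSpace Ω :=
  mComplete μ (⨆ a ∈ A, ⨆ s ≤ t, MeasurableSpace.comap (X a s) inferInstance)

/-- Conditional independence `m₁ ⟂ m₂ | m₃` of sub-σ-algebras:
`E[1_G | m₂ ∨ m₃] = E[1_G | m₃]` a.s. for every `G ∈ m₁`. -/
def CondIndepSigma [MeasurableSpace Ω] (μ : Measure Ω) (m₁ m₂ m₃ : MeasurableSpace Ω) :
    Prop :=
  ∀ s : Set Ω, MeasurableSet[m₁] s →
    μ[s.indicator fun _ => (1 : ℝ) | m₂ ⊔ m₃] =ᵐ[μ] μ[s.indicator fun _ => (1 : ℝ) | m₃]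

/-- `X_A` is (strongly) Granger-noncausal for `X_B` with respect to `ℱ_S`
(`X_A ⇸ X_B [ℱ_S]`): `ℱ_B(t+1) ⟂ ℱ_A(t) | ℱ_{S∖A}(t)` for all `t`. -/
def GrangerNoncausal {V : Type*} [MeasurableSpace Ω] (μ : Measure Ω)
    (X : V → ℤ → Ω → ℝ) (A B S : Set V) : Prop :=
  ∀ t : ℤ, CondIndepSigma μ (pastSigma μ X B (t + 1)) (pastSigma μ X A t)
    (pastSigma μ X (S \ A) t)

/-- `X_A` and `X_B` are contemporaneously conditionally independent with respect to
`ℱ_S` (`X_A ≁ X_B [ℱ_S]`): `ℱ_A(t+1) ⟂ ℱ_B(t+1) | ℱ_S(t) ∨ ℱ_{S∖(A∪B)}(t+1)`. -/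
def ContempIndep {V : Type*} [MeasurableSpace Ω] (μ : Measure Ω)
    (X : V → ℤ → Ω → ℝ) (A B S : Set V) : Prop :=
  ∀ t : ℤ, CondIndepSigma μ (pastSigma μ X A (t + 1)) (pastSigma μ X B (t + 1))
    (pastSigma μ X S t ⊔ pastSigma μ X (S \ (A ∪ B)) (t + 1))

/-! ### Granger-causal Markov properties (ground set `W`, usually `W = Set.univ`) -/

/-- (PC) the pairwise Granger-causal Markov property w.r.t. `G` (on ground set `W`). -/
def PairwiseMarkov {V : Type*} [MeasurableSpace Ω] (μ : Measure Ω)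
    (X : V → ℤ → Ω → ℝ) (G : MixedGraph V) (W : Set V) : Prop :=
  ∀ a ∈ W, ∀ b ∈ W, a ≠ b →
    (¬G.dir a b → GrangerNoncausal μ X {a} {b} W) ∧
    (¬G.undir a b → ContempIndep μ X {a} {b} W)

/-- (LC) the local Granger-causal Markov property w.r.t. `G` (on ground set `W`). -/
def LocalMarkov {V : Type*} [MeasurableSpace Ω] (μ : Measure Ω)
    (X : V → ℤ → Ω → ℝ) (G : MixedGraph V) (W : Set V) : Prop :=
  ∀ a ∈ W,
    GrangerNoncausal μ X (W \ (G.pa {a} ∪ {a})) {a} W ∧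
    ContempIndep μ X (W \ (G.nb {a} ∪ {a})) {a} W

/-- (BC) the block-recursive Granger-causal Markov property w.r.t. `G`
(on ground set `W`). -/
def BlockRecursiveMarkov {V : Type*} [MeasurableSpace Ω] (μ : Measure Ω)
    (X : V → ℤ → Ω → ℝ) (G : MixedGraph V) (W : Set V) : Prop :=
  ∀ A ⊆ W,
    GrangerNoncausal μ X (W \ (G.pa A ∪ A)) A W ∧
    ContempIndep μ X (W \ (G.nb A ∪ A)) A W

/-- (GC) the global Granger-causal Markov property w.r.t. `G`. -/
def GlobalMarkov {V : Type*} [MeasurableSpace Ω] (μ : Measure Ω)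
    (X : V → ℤ → Ω → ℝ) (G : MixedGraph V) : Prop :=
  ∀ A B S : Set V, Disjoint A B → Disjoint A S → Disjoint B S →
    ((∀ a ∈ A, ∀ b ∈ B, ∀ p : MGPath G a b, p.bPointing → ¬p.pConnecting (S ∪ B)) →
      GrangerNoncausal μ X A B (A ∪ B ∪ S)) ∧
    ((∀ a ∈ A, ∀ b ∈ B, ∀ p : MGPath G a b, p.extBiPointing →
        ¬p.pConnecting (A ∪ B ∪ S)) →
      ContempIndep μ X A B (A ∪ B ∪ S))

/-! ### Conditions (M) and (P) -/

/-- Stationarity: the joint law of `(X_V(t+s))_{s∈ℤ}` does not depend on `t`. -/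
def Stationary {V : Type*} [MeasurableSpace Ω] (μ : Measure Ω)
    (X : V → ℤ → Ω → ℝ) : Prop :=
  ∀ t : ℤ,
    Measure.map (fun ω => fun q : ℤ × V => X q.2 (t + q.1) ω) μ =
    Measure.map (fun ω => fun q : ℤ × V => X q.2 q.1 ω) μ

/-- Strong mixing: `sup |P(S₁ ∩ S₂) − P(S₁) P(S₂)| → 0` as `k → ∞`, the supremum being
over `S₁ ∈ σ(X_V(s) : s ≤ t)` and `S₂ ∈ σ(X_V(s) : s ≥ t + k)`. -/
def StrongMixing {V : Type*} [MeasurableSpace Ω] (μ : Measure Ω)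
    (X : V → ℤ → Ω → ℝ) : Prop :=
  ∀ t : ℤ, ∀ ε > (0 : ℝ), ∃ K : ℕ, ∀ k : ℕ, K ≤ k → ∀ S₁ S₂ : Set Ω,
    MeasurableSet[⨆ (v : V), ⨆ s ≤ t, MeasurableSpace.comap (X v s) inferInstance] S₁ →
    MeasurableSet[⨆ (v : V), ⨆ (s : ℤ) (_ : t + k ≤ s),
      MeasurableSpace.comap (X v s) inferInstance] S₂ →
    |(μ (S₁ ∩ S₂)).toReal - (μ S₁).toReal * (μ S₂).toReal| ≤ ε

/-- Condition (M): the process is stationary and strongly mixing. -/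
def ConditionM {V : Type*} [MeasurableSpace Ω] (μ : Measure Ω)
    (X : V → ℤ → Ω → ℝ) : Prop :=
  Stationary μ X ∧ StrongMixing μ X

/-- `ν` is a product measure on `ℝ^V`. -/
def IsProductMeasure {V : Type*} [Fintype V] (ν : Measure (V → ℝ)) : Prop :=
  ∃ νv : V → Measure ℝ, ∀ B : V → Set ℝ, (∀ v, MeasurableSet (B v)) →
    ν (Set.univ.pi B) = ∏ v, νv v (B v)

/-- The past trajectory `(X_V(s))_{s ≤ t}` of the process at time `t`. -/
def pastTraj {V : Type*} (X : V → ℤ → Ω → ℝ) (t : ℤ) (ω : Ω) : ℤ → V → ℝ :=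
  fun s v => if s ≤ t then X v s ω else 0

/-- Condition (P): the conditional distribution of `X_V(t+1)` given the past
`(X_V(s))_{s≤t}` has a regular version (a Markov kernel `κ` applied to the past
trajectory) that is almost surely absolutely continuous with respect to some product
measure `ν` on `ℝ^V` with a `ν`-a.e. positive and continuous density `f`. -/
def ConditionP {V : Type*} [Fintype V] [MeasurableSpace Ω] (μ : Measure Ω)
    (X : V → ℤ → Ω → ℝ) : Prop :=
  ∃ ν : Measure (V → ℝ), IsProductMeasure ν ∧
    ∀ t : ℤ, ∃ (κ : Kernel (ℤ → V → ℝ) (V → ℝ)) (f : (ℤ → V → ℝ) → (V → ℝ) → ℝ),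
      IsMarkovKernel κ ∧
      (∀ B : Set (V → ℝ), MeasurableSet B →
        (μ[fun ω => B.indicator (fun _ => (1 : ℝ)) (fun v => X v (t + 1) ω) |
            pastSigma μ X Set.univ t]) =ᵐ[μ]
          fun ω => (κ (pastTraj X t ω) B).toReal) ∧
      (∀ᵐ ω ∂μ,
        κ (pastTraj X t ω) =
          ν.withDensity (fun y => ENNReal.ofReal (f (pastTraj X t ω) y)) ∧
        (∀ᵐ y ∂ν, 0 < f (pastTraj X t ω) y ∧ ContinuousAt (f (pastTraj X t ω)) y))


/-! ### Product reference measures -/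

lemma exists_isOpen_measure_lt_top {α : Type*} [TopologicalSpace α] [MeasurableSpace α]
    [OpensMeasurableSpace α] {ν : Measure α} {f : α → ℝ}
    (hf : ∫⁻ y, ENNReal.ofReal (f y) ∂ν ≠ ⊤) {y : α} (hpos : 0 < f y)
    (hc : ContinuousAt f y) : ∃ U, IsOpen U ∧ y ∈ U ∧ ν U < ⊤ := by
  have hnhds : {x | f y / 2 < f x} ∈ nhds y :=
    hc.eventually (lt_mem_nhds (half_lt_self hpos))
  obtain ⟨U, hUsub, hUo, hyU⟩ := mem_nhds_iff.1 hnhds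
  refine ⟨U, hUo, hyU, ?_⟩
  have hle : ENNReal.ofReal (f y / 2) * ν U ≤ ∫⁻ y, ENNReal.ofReal (f y) ∂ν := by
    rw [← setLIntegral_const, ← lintegral_indicator hUo.measurableSet]
    refine lintegral_mono fun x => ?_
    by_cases hx : x ∈ U
    · simpa [hx] using ENNReal.ofReal_le_ofReal (hUsub hx).le
    · simp [hx]
  have hne : ENNReal.ofReal (f y / 2) ≠ 0 := by simpa using half_pos hpos
  by_contra hU
  rw [not_lt, top_le_iff] at hU
  rw [hU, ENNReal.mul_top hne, top_le_iff] at hle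
  exact hf hle

lemma aemeasurable_of_ae_continuousAt {α : Type*} [TopologicalSpace α] [MeasurableSpace α]
    [BorelSpace α] {ν : Measure α} {f : α → ℝ} (hf : ∀ᵐ y ∂ν, ContinuousAt f y) :
    AEMeasurable f ν := by
  have hS : MeasurableSet {y | ContinuousAt f y} := (IsGδ.setOfPred_continuousAt f).measurableSet
  have hcont : ContinuousOn f {y | ContinuousAt f y} := fun y hy => hy.continuousWithinAt
  have := hcont.aemeasurable (μ := ν) hS
  rwa [Measure.restrict_eq_self_of_ae_mem (s := {y | ContinuousAt f y}) hf] at this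

/-- The factors of a nonzero product measure are σ-finite as soon as almost every point has a
neighbourhood of finite measure. -/
lemma sigmaFinite_factor {V : Type*} [Fintype V] {ν : Measure (V → ℝ)} {νv : V → Measure ℝ}
    (hprod : ∀ B : V → Set ℝ, (∀ v, MeasurableSet (B v)) →
      ν (Set.univ.pi B) = ∏ v, νv v (B v))
    (h0 : ν Set.univ ≠ 0) (hfin : ∀ᵐ y ∂ν, ∃ U, IsOpen U ∧ y ∈ U ∧ ν U < ⊤) (v : V) :
    SigmaFinite (νv v) := by
  classical
  let 𝓑 := TopologicalSpace.countableBasis ℝ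
  have h𝓑 : TopologicalSpace.IsTopologicalBasis 𝓑 :=
    TopologicalSpace.isBasis_countableBasis ℝ
  have : Countable 𝓑 := (TopologicalSpace.countable_countableBasis ℝ).to_subtype
  let box : (V → 𝓑) → Set (V → ℝ) := fun b => Set.univ.pi fun w => (b w : Set ℝ)
  have hopen : ∀ b : 𝓑, IsOpen (b : Set ℝ) := fun b => h𝓑.isOpen b.2
  have hbox : ∀ b, ν (box b) = ∏ w, νv w (b w) := fun b =>
    hprod _ fun w => (hopen _).measurableSet
  have hcover : ∀ᵐ y ∂ν, ∃ b, y ∈ box b ∧ ν (box b) < ⊤ := by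
    filter_upwards [hfin] with y ⟨U, hUo, hyU, hU⟩
    obtain ⟨u, hu, huU⟩ := isOpen_pi_iff'.1 hUo y hyU
    choose b hb hyb hbu using fun w => h𝓑.exists_subset_of_mem_open (hu w).2 (hu w).1
    refine ⟨fun w => ⟨b w, hb w⟩, fun w _ => hyb w, lt_of_le_of_lt (measure_mono ?_) hU⟩
    exact (Set.pi_mono fun w _ => hbu w).trans huU
  let K : Set (V → 𝓑) := {b | ν (box b) < ⊤ ∧ ν (box b) ≠ 0}
  let N : Set ℝ := (⋃ b ∈ K, (b v : Set ℝ))ᶜ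
  have hNmeas : MeasurableSet N :=
    (isOpen_biUnion fun b _ => hopen (b v)).measurableSet.compl
  have hnull : ∀ᵐ y ∂ν, ∀ b, ν (box b) = 0 → y ∉ box b := by
    rw [ae_all_iff]
    intro b
    by_cases hb : ν (box b) = 0
    · simpa [hb] using measure_eq_zero_iff_ae_notMem.1 hb
    · simp [hb]
  have hN : νv v N = 0 := by
    have hcyl : ν (Set.univ.pi (Function.update (fun _ => Set.univ) v N)) = 0 := by
      rw [measure_eq_zero_iff_ae_notMem]
      filter_upwards [hcover, hnull] with y ⟨b, hyb, hb⟩ hy hmem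
      have hyN : y v ∈ N := by simpa using hmem v (Set.mem_univ v)
      refine hyN (Set.mem_biUnion (x := b) ⟨hb, fun h => hy b h hyb⟩ (hyb v (Set.mem_univ v)))
    rw [hprod _ fun w => by
      by_cases h : w = v
      · subst h; simpa using hNmeas
      · simp [h], Finset.prod_eq_zero_iff] at hcyl
    obtain ⟨w, -, hw⟩ := hcyl
    by_cases h : w = v
    · subst h; simpa using hw
    · refine absurd ?_ h0
      rw [← Set.pi_univ Set.univ, hprod _ fun _ => MeasurableSet.univ]
      exact Finset.prod_eq_zero (Finset.mem_univ w) (by simpa [h] using hw)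
  refine Measure.sigmaFinite_of_countable
    (S := insert N ((fun b : V → 𝓑 => (b v : Set ℝ)) '' K))
    ((Set.to_countable K).image _ |>.insert N) ?_ ?_
  · rintro s (rfl | ⟨b, ⟨hb, hb0⟩, rfl⟩)
    · simp [hN]
    · rw [hbox] at hb hb0
      rw [lt_top_iff_ne_top]
      intro htop
      rw [← Finset.mul_prod_erase _ _ (Finset.mem_univ v)] at hb hb0
      change νv v (b v) = ⊤ at htop
      rw [htop, ENNReal.top_mul (right_ne_zero_of_mul hb0)] at hb
      exact lt_irrefl _ hb
  · rw [Set.sUnion_insert, Set.sUnion_image]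
    exact Set.compl_union_self _

lemma ae_ae_update_of_ae_pi {ι : Type*} [Fintype ι] [DecidableEq ι] (νv : ι → Measure ℝ)
    [∀ i, SigmaFinite (νv i)] {M : Set (ι → ℝ)} (hM : MeasurableSet M)
    (h : ∀ᵐ y ∂Measure.pi νv, y ∉ M) (i : ι) :
    ∀ᵐ z ∂νv i, ∀ᵐ y ∂Measure.pi νv, Function.update y i z ∉ M := by
  have key : ∀ (f : (ι → ℝ) → ENNReal), Measurable f → ∀ x,
      ∫⁻ y, f y ∂Measure.pi νv =
        ∫⁻ z, (∫⋯∫⁻_Finset.univ.erase i, f ∂νv) (Function.update x i z) ∂νv i := by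
    intro f hf x
    rw [lintegral_eq_lmarginal_univ x, lmarginal_erase f hf (Finset.mem_univ i)]
  have hmeas : Measurable (M.indicator (1 : (ι → ℝ) → ENNReal)) :=
    measurable_one.indicator hM
  have hzero := key _ hmeas 0
  rw [lintegral_indicator_one hM, measure_eq_zero_iff_ae_notMem.2 h, eq_comm,
    lintegral_eq_zero_iff (f := fun z => (∫⋯∫⁻_Finset.univ.erase i, M.indicator 1 ∂νv)
      (Function.update 0 i z)) ((hmeas.lmarginal νv).comp (measurable_update 0))] at hzero
  filter_upwards [hzero] with z hz
  have hupd : Measurable fun y : ι → ℝ => Function.update y i z :=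
    measurable_update_left
  have hM' : MeasurableSet ((fun y : ι → ℝ => Function.update y i z) ⁻¹' M) := hupd hM
  change ∀ᵐ y ∂Measure.pi νv, y ∉ (fun y : ι → ℝ => Function.update y i z) ⁻¹' M
  rw [← measure_eq_zero_iff_ae_notMem, ← lintegral_indicator_one hM',
    key _ (measurable_one.indicator hM') 0]
  have : ∀ z', (∫⋯∫⁻_Finset.univ.erase i,
      ((fun y : ι → ℝ => Function.update y i z) ⁻¹' M).indicator 1 ∂νv)
        (Function.update 0 i z') = 0 := by
    intro z'
    rw [Pi.zero_apply, lmarginal_update_of_notMem hmeas (Finset.notMem_erase i _)] at hz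
    rw [lmarginal_update_of_notMem (measurable_one.indicator hM') (Finset.notMem_erase i _),
      ← hz]
    refine congrArg (fun F => (∫⋯∫⁻_Finset.univ.erase i, F ∂νv) 0) (funext fun y => ?_)
    have hiff : Function.update y i z' ∈ (fun y : ι → ℝ => Function.update y i z) ⁻¹' M ↔
        Function.update y i z ∈ M := by
      rw [Set.mem_preimage, Function.update_idem]
    by_cases hy : Function.update y i z ∈ M
    · rw [Function.comp_apply, Function.comp_apply, Set.indicator_of_mem (hiff.2 hy),
        Set.indicator_of_mem hy, Pi.one_apply, Pi.one_apply]
    · rw [Function.comp_apply, Function.comp_apply, Set.indicator_of_notMem (mt hiff.1 hy),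
        Set.indicator_of_notMem hy]
  simp [this]


/-! ### Past trajectories -/

lemma measurable_pastTraj {V Ω : Type*} [MeasurableSpace Ω] {X : V → ℤ → Ω → ℝ}
    (hX : ∀ v t, Measurable (X v t)) (t : ℤ) : Measurable (pastTraj X t) := by
  refine measurable_pi_lambda _ fun s => measurable_pi_lambda _ fun v => ?_
  by_cases h : s ≤ t
  · simpa [pastTraj, h] using hX v s
  · simp [pastTraj, h]

/-- Overwrite the values of a trajectory at time `s` by `y`. -/
def setTime {V : Type*} (s : ℤ) (h : ℤ → V → ℝ) (y : V → ℝ) : ℤ → V → ℝ :=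
  Function.update h s y

/-- Overwrite a trajectory on the coordinates in `Y` by the values of `z`. -/
def overwrite {V : Type*} (Y : Set (V × ℤ)) (z : V × ℤ → ℝ) (h : ℤ → V → ℝ) : ℤ → V → ℝ :=
  open Classical in fun s v => if (v, s) ∈ Y then z (v, s) else h s v

@[simp]
lemma overwrite_empty {V : Type*} (z : V × ℤ → ℝ) (h : ℤ → V → ℝ) : overwrite ∅ z h = h := by
  ext s v
  simp [overwrite]

lemma measurable_setTime {V : Type*} (s : ℤ) :
    Measurable fun p : (ℤ → V → ℝ) × (V → ℝ) => setTime s p.1 p.2 := by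
  refine measurable_pi_lambda _ fun r => ?_
  by_cases h : r = s
  · subst h; simpa [setTime] using measurable_snd
  · simpa [setTime, h] using measurable_fst.eval

lemma measurable_overwrite {V : Type*} (Y : Set (V × ℤ)) :
    Measurable fun p : (V × ℤ → ℝ) × (ℤ → V → ℝ) => overwrite Y p.1 p.2 := by
  refine measurable_pi_lambda _ fun s => measurable_pi_lambda _ fun v => ?_
  by_cases h : (v, s) ∈ Y
  · simpa [overwrite, h] using measurable_fst.eval
  · simpa [overwrite, h] using measurable_snd.eval.eval

lemma pastTraj_succ {V Ω : Type*} (X : V → ℤ → Ω → ℝ) (t : ℤ) (ω : Ω) :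
    pastTraj X (t + 1) ω = setTime (t + 1) (pastTraj X t ω) fun v => X v (t + 1) ω := by
  ext s v
  rcases lt_trichotomy s (t + 1) with h | h | h
  · simp [pastTraj, setTime, h.ne, h.le, Int.lt_add_one_iff.1 h]
  · simp [pastTraj, setTime, h]
  · simp [pastTraj, setTime, h.ne', h.not_ge, show ¬ s ≤ t by omega]

/-- Conditional expectations given a σ-algebra that is not contained in the ambient one vanish by
convention, which condition (P) excludes. -/
lemma pastSigma_le_of_conditionP {V Ω : Type*} [Fintype V] [MeasurableSpace Ω] {μ : Measure Ω}
    [IsProbabilityMeasure μ] {X : V → ℤ → Ω → ℝ} (hP : ConditionP μ X) (t : ℤ) :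
    pastSigma μ X Set.univ t ≤ ‹MeasurableSpace Ω› := by
  obtain ⟨ν, -, h⟩ := hP
  obtain ⟨κ, f, hκ, hc, -⟩ := h t
  by_contra hm
  have h1 := hc Set.univ MeasurableSet.univ
  rw [condExp_of_not_le hm] at h1
  have : ∀ᵐ ω ∂μ, False := by
    filter_upwards [h1] with ω hω
    simp at hω
  exact NeZero.ne μ (ae_eq_bot.1 (eventually_false_iff_eq_bot.1 this))

lemma measurable_pastTraj_pastSigma {V Ω : Type*} [MeasurableSpace Ω] (μ : Measure Ω)
    (X : V → ℤ → Ω → ℝ) (t : ℤ) :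
    Measurable[pastSigma μ X Set.univ t] (pastTraj X t) := by
  refine @measurable_pi_lambda _ _ _ (_) _ _ fun s =>
    @measurable_pi_lambda _ _ _ (_) _ _ fun v => ?_
  by_cases h : s ≤ t
  · have : MeasurableSpace.comap (X v s) inferInstance ≤ pastSigma μ X Set.univ t :=
      le_trans (le_iSup₂_of_le v (Set.mem_univ v) (le_iSup₂_of_le
        (f := fun s (_ : s ≤ t) => MeasurableSpace.comap (X v s) inferInstance) s h le_rfl))
        le_sup_left
    simpa [pastTraj, h] using measurable_iff_comap_le.2 this
  · simp only [pastTraj, h, if_false]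
    exact @measurable_const _ _ (_) (_) _

lemma map_pastTraj_eq_compProd {V Ω : Type*} [Fintype V] [MeasurableSpace Ω] {μ : Measure Ω}
    [IsProbabilityMeasure μ] {X : V → ℤ → Ω → ℝ} (hX : ∀ v t, Measurable (X v t)) {t : ℤ}
    (hle : pastSigma μ X Set.univ t ≤ ‹MeasurableSpace Ω›)
    {κ : Kernel (ℤ → V → ℝ) (V → ℝ)} [IsMarkovKernel κ]
    (hκ : ∀ B : Set (V → ℝ), MeasurableSet B →
      (μ[fun ω => B.indicator (fun _ => (1 : ℝ)) (fun v => X v (t + 1) ω) |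
          pastSigma μ X Set.univ t]) =ᵐ[μ] fun ω => (κ (pastTraj X t ω) B).toReal) :
    μ.map (fun ω => (pastTraj X t ω, fun v => X v (t + 1) ω)) =
      (μ.map (pastTraj X t)) ⊗ₘ κ := by
  have hpt := measurable_pastTraj hX t
  have hnext : Measurable fun ω => fun v => X v (t + 1) ω :=
    measurable_pi_lambda _ fun v => hX v (t + 1)
  have := Measure.isProbabilityMeasure_map (μ := μ) hpt.aemeasurable
  have := Measure.isProbabilityMeasure_map (μ := μ) (hpt.prodMk hnext).aemeasurable
  refine Measure.ext_prod fun {A B} hA hB => ?_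
  have hA' := measurable_pastTraj_pastSigma μ X t hA
  rw [Measure.compProd_apply_prod hA hB, setLIntegral_map hA (κ.measurable_coe hB) hpt,
    Measure.map_apply (hpt.prodMk hnext) (hA.prod hB)]
  have hint : Integrable (fun ω => B.indicator (fun _ => (1 : ℝ)) (fun v => X v (t + 1) ω)) μ :=
    (integrable_const (1 : ℝ)).indicator (hnext hB)
  have h1 := setIntegral_condExp hle hint hA'
  rw [setIntegral_congr_ae (hle _ hA') ((hκ B hB).mono fun ω h _ => h)] at h1
  have h2 : ∫ ω in pastTraj X t ⁻¹' A,
      B.indicator (fun _ => (1 : ℝ)) (fun v => X v (t + 1) ω) ∂μ =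
      μ.real ((fun ω => (pastTraj X t ω, fun v => X v (t + 1) ω)) ⁻¹' A ×ˢ B) := by
    change ∫ ω in pastTraj X t ⁻¹' A,
      ((fun ω => fun v => X v (t + 1) ω) ⁻¹' B).indicator (fun _ => (1 : ℝ)) ω ∂μ = _
    rw [integral_indicator (hnext hB), Measure.restrict_restrict (hnext hB)]
    simp [Set.mk_preimage_prod, Set.inter_comm]
  rw [h2, integral_toReal (f := fun ω => κ (pastTraj X t ω) B)
    ((κ.measurable_coe hB).comp hpt).aemeasurable
    (ae_of_all _ fun ω => measure_lt_top _ _)] at h1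
  refine ((ENNReal.toReal_eq_toReal_iff' ?_ (measure_ne_top _ _)).1 h1).symm
  refine ((setLIntegral_le_lintegral _ _).trans_lt ?_).ne
  calc ∫⁻ ω, κ (pastTraj X t ω) B ∂μ ≤ ∫⁻ ω, 1 ∂μ := lintegral_mono fun ω => prob_le_one
    _ < ⊤ := by simp

/-- One step ahead, the conditional law of the process has the same null sets as the
reference measure `ν`. -/
def HasReferenceMeasure {V Ω : Type*} [MeasurableSpace Ω] (μ : Measure Ω)
    (X : V → ℤ → Ω → ℝ) (ν : Measure (V → ℝ)) : Prop :=
  ∀ (t : ℤ) (N : Set ((ℤ → V → ℝ) × (V → ℝ))), MeasurableSet N →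
    ((∀ᵐ ω ∂μ, (pastTraj X t ω, fun v => X v (t + 1) ω) ∉ N) ↔
      ∀ᵐ ω ∂μ, ∀ᵐ y ∂ν, (pastTraj X t ω, y) ∉ N)

lemma ConditionP.exists_hasReferenceMeasure {V Ω : Type*} [Fintype V] [MeasurableSpace Ω]
    {μ : Measure Ω} [IsProbabilityMeasure μ] {X : V → ℤ → Ω → ℝ}
    (hX : ∀ v t, Measurable (X v t)) (hP : ConditionP μ X) :
    ∃ νv : V → Measure ℝ, (∀ v, SigmaFinite (νv v)) ∧ (∀ v, NeZero (νv v)) ∧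
      HasReferenceMeasure μ X (Measure.pi νv) := by
  have hle := pastSigma_le_of_conditionP hP
  obtain ⟨ν, ⟨νv, hprod⟩, h⟩ := hP
  have h0 : ν Set.univ ≠ 0 := by
    obtain ⟨κ, f, hκ, -, hf⟩ := h 0
    obtain ⟨ω, hω, -⟩ := hf.exists
    intro hν
    have h1 : κ (pastTraj X 0 ω) Set.univ = 1 := measure_univ
    rw [hω, Measure.measure_univ_eq_zero.1 hν] at h1
    simp at h1
  have hfin : ∀ᵐ y ∂ν, ∃ U, IsOpen U ∧ y ∈ U ∧ ν U < ⊤ := by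
    obtain ⟨κ, f, hκ, -, hf⟩ := h 0
    obtain ⟨ω, hω, hpos⟩ := hf.exists
    have h1 : κ (pastTraj X 0 ω) Set.univ = 1 := measure_univ
    rw [hω, withDensity_apply _ MeasurableSet.univ, setLIntegral_univ] at h1
    filter_upwards [hpos] with y hy
    exact exists_isOpen_measure_lt_top (by simp [h1]) hy.1 hy.2
  have hσ : ∀ v, SigmaFinite (νv v) := sigmaFinite_factor hprod h0 hfin
  have hpi : Measure.pi νv = ν := Measure.pi_eq hprod
  refine ⟨νv, hσ, fun v => ⟨fun hv => h0 ?_⟩, fun t N hN => ?_⟩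
  · rw [← Set.pi_univ Set.univ, hprod _ fun _ => MeasurableSet.univ]
    exact Finset.prod_eq_zero (Finset.mem_univ v) (by simp [hv])
  · obtain ⟨κ, f, hκ, hc, hf⟩ := h t
    have hpt := measurable_pastTraj hX t
    have hnext : Measurable fun ω => fun v => X v (t + 1) ω :=
      measurable_pi_lambda _ fun v => hX v (t + 1)
    have := Measure.isProbabilityMeasure_map (μ := μ) hpt.aemeasurable
    have h1 : (∀ᵐ ω ∂μ, (pastTraj X t ω, fun v => X v (t + 1) ω) ∉ N) ↔
        ∀ᵐ ω ∂μ, κ (pastTraj X t ω) (Prod.mk (pastTraj X t ω) ⁻¹' N) = 0 := by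
      change (∀ᵐ ω ∂μ, ω ∉ (fun ω => (pastTraj X t ω, fun v => X v (t + 1) ω)) ⁻¹' N) ↔ _
      rw [← measure_eq_zero_iff_ae_notMem, ← Measure.map_apply (hpt.prodMk hnext) hN,
        map_pastTraj_eq_compProd hX (hle t) hc, Measure.compProd_apply hN,
        lintegral_map (Kernel.measurable_kernel_prodMk_left hN) hpt,
        lintegral_eq_zero_iff
          (f := fun ω => κ (pastTraj X t ω) (Prod.mk (pastTraj X t ω) ⁻¹' N))
          ((Kernel.measurable_kernel_prodMk_left hN).comp hpt)]
      rfl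
    rw [h1, hpi]
    refine eventually_congr ?_
    filter_upwards [hf] with ω ⟨hω, hpos⟩
    have hac : κ (pastTraj X t ω) ≪ ν := hω ▸ withDensity_absolutelyContinuous _ _
    have hac' : ν ≪ κ (pastTraj X t ω) := by
      rw [hω]
      refine withDensity_absolutelyContinuous' ?_ ?_
      · exact (aemeasurable_of_ae_continuousAt (hpos.mono fun y hy => hy.2)).ennreal_ofReal
      · filter_upwards [hpos] with y hy
        simpa using hy.1
    exact (Iff.intro (fun h => hac' h) fun h => hac h).trans measure_eq_zero_iff_ae_notMem

/-- A null set of past trajectories stays null after one coordinate is replaced by a suitable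
constant. -/
lemma HasReferenceMeasure.exists_overwrite_single {V Ω : Type*} [Fintype V]
    [MeasurableSpace Ω] {μ : Measure Ω} [IsProbabilityMeasure μ] {X : V → ℤ → Ω → ℝ}
    (hX : ∀ v t, Measurable (X v t)) {νv : V → Measure ℝ} [∀ v, SigmaFinite (νv v)]
    [∀ v, NeZero (νv v)] (hν : HasReferenceMeasure μ X (Measure.pi νv)) (v : V) {s t : ℤ}
    (hst : s ≤ t) {N : Set (ℤ → V → ℝ)} (hN : MeasurableSet N)
    (h : ∀ᵐ ω ∂μ, pastTraj X t ω ∉ N) :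
    ∃ z : ℝ, ∀ᵐ ω ∂μ, overwrite {(v, s)} (fun _ => z) (pastTraj X t ω) ∉ N := by
  classical
  obtain ⟨n, rfl⟩ := Int.le.dest hst
  clear hst
  induction n generalizing N with
  | zero =>
    obtain ⟨r, rfl⟩ : ∃ r, s = r + 1 := ⟨s - 1, by ring⟩
    have hN' := measurable_setTime (V := V) (r + 1) hN
    have h1 := (hν r _ hN').1 (by simpa [pastTraj_succ] using h)
    have h2 : ∀ᵐ ω ∂μ, ∀ᵐ z ∂νv v, ∀ᵐ y ∂Measure.pi νv,
        setTime (r + 1) (pastTraj X r ω) (Function.update y v z) ∉ N := by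
      filter_upwards [h1] with ω hω
      exact ae_ae_update_of_ae_pi νv (measurable_prodMk_left hN') hω v
    have hupd : Measurable fun p : ((ℤ → V → ℝ) × ℝ) × (V → ℝ) =>
        setTime (r + 1) p.1.1 (Function.update p.2 v p.1.2) := by
      refine (measurable_setTime (r + 1)).comp (f := fun p : ((ℤ → V → ℝ) × ℝ) × (V → ℝ) =>
        (p.1.1, Function.update p.2 v p.1.2)) ?_
      exact (measurable_fst.comp measurable_fst).prodMk
        (measurable_update'.comp (measurable_snd.prodMk (measurable_snd.comp measurable_fst)))
    have hset : MeasurableSet {p : Ω × ℝ | ∀ᵐ y ∂Measure.pi νv,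
        setTime (r + 1) (pastTraj X r p.1) (Function.update y v p.2) ∉ N} := by
      have hm : Measurable fun p : Ω × ℝ => Measure.pi νv
          (Prod.mk (pastTraj X r p.1, p.2) ⁻¹' ((fun p : ((ℤ → V → ℝ) × ℝ) × (V → ℝ) =>
            setTime (r + 1) p.1.1 (Function.update p.2 v p.1.2)) ⁻¹' N)) :=
        (measurable_measure_prodMk_left (hupd hN)).comp
          (((measurable_pastTraj hX r).comp measurable_fst).prodMk measurable_snd)
      convert hm (measurableSet_singleton 0) using 1
      ext p
      exact measure_eq_zero_iff_ae_notMem.symm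
    rw [Measure.ae_ae_comm hset] at h2
    obtain ⟨z, hz⟩ := h2.exists
    refine ⟨z, ?_⟩
    have hN'' : MeasurableSet {p : (ℤ → V → ℝ) × (V → ℝ) |
        setTime (r + 1) p.1 (Function.update p.2 v z) ∈ N} :=
      hupd.comp (f := fun p : (ℤ → V → ℝ) × (V → ℝ) => ((p.1, z), p.2))
        ((measurable_fst.prodMk measurable_const).prodMk measurable_snd) hN
    have h3 := (hν r _ hN'').2 hz
    filter_upwards [h3] with ω hω
    convert hω using 1
    simp only [Nat.cast_zero, add_zero, pastTraj_succ]
    congr! 1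
    ext a b
    by_cases ha : a = r + 1
    · subst ha
      by_cases hb : b = v
      · subst hb; simp [overwrite, setTime]
      · simp [overwrite, setTime, hb]
    · simp [overwrite, setTime, ha]
  | succ n ih =>
    have hsucc : s + ((n + 1 : ℕ) : ℤ) = s + n + 1 := by push_cast; ring
    rw [hsucc] at h ⊢
    have hN' := measurable_setTime (V := V) (s + n + 1) hN
    have h1 := (hν (s + n) _ hN').1 (by simpa [pastTraj_succ] using h)
    let N₁ : Set (ℤ → V → ℝ) := {g | ∀ᵐ y ∂Measure.pi νv, setTime (s + n + 1) g y ∉ N}ᶜ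
    have hN₁ : MeasurableSet N₁ := by
      refine MeasurableSet.compl ?_
      convert measurable_measure_prodMk_left (ν := Measure.pi νv) hN'
        (measurableSet_singleton 0) using 1
      ext p
      exact measure_eq_zero_iff_ae_notMem.symm
    obtain ⟨z, hz⟩ := ih (N := N₁) hN₁ (by
      filter_upwards [h1] with ω hω hmem
      exact hmem hω)
    refine ⟨z, ?_⟩
    have how : Measurable fun p : (ℤ → V → ℝ) × (V → ℝ) =>
        setTime (s + n + 1) (overwrite {(v, s)} (fun _ => z) p.1) p.2 :=
      (measurable_setTime (s + n + 1)).comp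
        (f := fun p : (ℤ → V → ℝ) × (V → ℝ) => (overwrite {(v, s)} (fun _ => z) p.1, p.2))
        (((measurable_overwrite {(v, s)}).comp
          (f := fun p : (ℤ → V → ℝ) × (V → ℝ) => ((fun _ => z : V × ℤ → ℝ), p.1))
          (measurable_const.prodMk measurable_fst)).prodMk measurable_snd)
    have h3 := (hν (s + n) _ (how hN)).2 (by
      filter_upwards [hz] with ω hω
      exact not_not.1 hω)
    filter_upwards [h3] with ω hω
    convert hω using 1
    simp only [pastTraj_succ, Set.mem_preimage]
    congr! 1
    ext a b
    by_cases ha : a = s + n + 1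
    · subst ha
      simp [overwrite, setTime, show s + (n : ℤ) + 1 ≠ s by omega]
    · simp [overwrite, setTime, ha]

/-- A null set of past trajectories stays null after finitely many coordinates are replaced by
suitable constants. -/
lemma HasReferenceMeasure.exists_overwrite {V Ω : Type*} [Fintype V]
    [MeasurableSpace Ω] {μ : Measure Ω} [IsProbabilityMeasure μ] {X : V → ℤ → Ω → ℝ}
    (hX : ∀ v t, Measurable (X v t)) {νv : V → Measure ℝ} [∀ v, SigmaFinite (νv v)]
    [∀ v, NeZero (νv v)] (hν : HasReferenceMeasure μ X (Measure.pi νv)) {t : ℤ}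
    (Y : Finset (V × ℤ)) (hY : ∀ q ∈ Y, q.2 ≤ t) {N : Set (ℤ → V → ℝ)} (hN : MeasurableSet N)
    (h : ∀ᵐ ω ∂μ, pastTraj X t ω ∉ N) :
    ∃ z : V × ℤ → ℝ, ∀ᵐ ω ∂μ, overwrite Y z (pastTraj X t ω) ∉ N := by
  classical
  induction Y using Finset.induction_on generalizing N with
  | empty => exact ⟨0, by simpa [overwrite_empty] using h⟩
  | insert q Y hq ih =>
    obtain ⟨x, hx⟩ := hν.exists_overwrite_single hX q.1 (hY q (Finset.mem_insert_self q Y)) hN h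
    have how : Measurable (overwrite {q} fun _ => x) :=
      (measurable_overwrite {q}).comp
        (f := fun h : ℤ → V → ℝ => ((fun _ => x : V × ℤ → ℝ), h))
        (measurable_const.prodMk measurable_id)
    obtain ⟨z, hz⟩ := ih (fun p hp => hY p (Finset.mem_insert_of_mem hp)) (how hN) hx
    refine ⟨Function.update z q x, ?_⟩
    filter_upwards [hz] with ω hω
    convert hω using 1
    simp only [Set.mem_preimage]
    congr! 1
    ext a b
    by_cases hqa : (b, a) = q
    · simp [overwrite, hqa]
    · simp [overwrite, hqa]

/-! ### Completions and σ-algebras generated by coordinates -/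

lemma measurableSet_mComplete_iff {Ω : Type*} {m : MeasurableSpace Ω} [MeasurableSpace Ω]
    {μ : Measure Ω} {S : Set Ω} :
    MeasurableSet[mComplete μ m] S ↔ ∃ A, MeasurableSet[m] A ∧ S =ᵐ[μ] A := by
  constructor
  · have hle : mComplete μ m ≤ eventuallyMeasurableSpace m (ae μ) := by
      refine sup_le le_eventuallyMeasurableSpace (MeasurableSpace.generateFrom_le fun s hs => ?_)
      exact ⟨∅, @MeasurableSet.empty _ m, ae_eq_empty.2 hs⟩
    exact fun hS => hle S hS
  · rintro ⟨A, hA, hSA⟩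
    have hnull : ∀ s : Set Ω, μ s = 0 → MeasurableSet[mComplete μ m] s := fun s hs =>
      le_sup_right (a := m) s (MeasurableSpace.measurableSet_generateFrom hs)
    have hA' : MeasurableSet[mComplete μ m] A := le_sup_left (a := m) A hA
    obtain ⟨h₁, h₂⟩ := ae_eq_set.1 hSA
    have hS : S = A \ (A \ S) ∪ S \ A := by
      ext x
      by_cases hx : x ∈ S <;> by_cases hx' : x ∈ A <;> simp [hx, hx']
    rw [hS]
    exact (hA'.diff (hnull _ h₂)).union (hnull _ h₁)

lemma mComplete_mono {Ω : Type*} {m₁ m₂ : MeasurableSpace Ω} [MeasurableSpace Ω]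
    (μ : Measure Ω) (h : m₁ ≤ m₂) : mComplete μ m₁ ≤ mComplete μ m₂ :=
  sup_le_sup_right h _

/-- The values of a trajectory on the coordinates in `I`. -/
def coords {V : Type*} (I : Set (V × ℤ)) (h : ℤ → V → ℝ) : I → ℝ := fun q => h q.1.2 q.1.1

lemma measurable_coords {V : Type*} (I : Set (V × ℤ)) : Measurable (coords I) :=
  measurable_pi_lambda _ fun q =>
    (measurable_pi_apply (X := fun _ : V => ℝ) q.1.1).comp (measurable_pi_apply q.1.2)

lemma iSup_comap_eq_comap_coords {V Ω : Type*} (X : V → ℤ → Ω → ℝ) {t : ℤ}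
    {I : Set (V × ℤ)} (hI : ∀ q ∈ I, q.2 ≤ t) :
    (⨆ q ∈ I, MeasurableSpace.comap (X q.1 q.2) inferInstance) =
      MeasurableSpace.comap (fun ω => coords I (pastTraj X t ω)) MeasurableSpace.pi := by
  rw [MeasurableSpace.pi, MeasurableSpace.comap_iSup, iSup_subtype']
  refine iSup_congr fun q => ?_
  rw [MeasurableSpace.comap_comp]
  congr 1
  ext ω
  simp [coords, pastTraj, hI q q.2]

lemma coords_overwrite_of_disjoint {V : Type*} {I Y : Set (V × ℤ)} (h : Disjoint I Y)
    (z : V × ℤ → ℝ) (g : ℤ → V → ℝ) : coords I (overwrite Y z g) = coords I g := by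
  ext q
  simp [coords, overwrite, Set.disjoint_left.1 h q.2]

lemma measurable_coords_overwrite {V Ω : Type*} (X : V → ℤ → Ω → ℝ) {t : ℤ}
    {G Y : Set (V × ℤ)} (hG : ∀ q ∈ G, q.2 ≤ t) (z : V × ℤ → ℝ) :
    Measurable[⨆ q ∈ G, MeasurableSpace.comap (X q.1 q.2) inferInstance]
      fun ω => coords (Y ∪ G) (overwrite Y z (pastTraj X t ω)) := by
  refine @measurable_pi_lambda _ _ _ (_) _ _ fun q => ?_
  by_cases hq : q.1 ∈ Y
  · simp only [coords, overwrite, hq, if_true]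
    exact @measurable_const _ _ (_) (_) _
  · have hqG : q.1 ∈ G := q.2.resolve_left hq
    have hle : MeasurableSpace.comap (X q.1.1 q.1.2) inferInstance ≤
        ⨆ q ∈ G, MeasurableSpace.comap (X q.1 q.2) inferInstance :=
      le_iSup₂_of_le (f := fun (q : V × ℤ) (_ : q ∈ G) =>
        MeasurableSpace.comap (X q.1 q.2) inferInstance) q.1 hqG le_rfl
    simpa [coords, overwrite, hq, pastTraj, hG q.1 hqG] using measurable_iff_comap_le.2 hle

/-- Lemma: finite measurable separation. If `X_V` is stationary and
satisfies condition (P), then any two finite disjoint subsets `Y₁, Y₂` of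
`S(t) = {X_v(s) : v ∈ V, s ≤ t}` (given by finite disjoint index sets in `V × ℤ`) are
measurably separated conditionally on the σ-algebra generated by `S(t) ∖ (Y₁ ∪ Y₂)`:
`(σ(Y₁) ∨ 𝒢) ∩ (σ(Y₂) ∨ 𝒢) = 𝒢` (all σ-algebras `μ`-completed). -/
theorem finite_measurable_separation
    {V Ω : Type*} [Fintype V] [MeasurableSpace Ω]
    (μ : Measure Ω) [IsProbabilityMeasure μ]
    (X : V → ℤ → Ω → ℝ) (hXmeas : ∀ v t, Measurable (X v t))
    (hstat : Stationary μ X) (hP : ConditionP μ X)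
    (t : ℤ) (Y₁ Y₂ : Finset (V × ℤ))
    (hY₁ : ∀ q ∈ Y₁, q.2 ≤ t) (hY₂ : ∀ q ∈ Y₂, q.2 ≤ t)
    (hdisj : Disjoint Y₁ Y₂) :
    mComplete μ
        ((⨆ q ∈ Y₁, MeasurableSpace.comap (X q.1 q.2) inferInstance) ⊔
          (⨆ q ∈ {q : V × ℤ | q.2 ≤ t ∧ q ∉ Y₁ ∧ q ∉ Y₂},
            MeasurableSpace.comap (X q.1 q.2) inferInstance)) ⊓
      mComplete μ
        ((⨆ q ∈ Y₂, MeasurableSpace.comap (X q.1 q.2) inferInstance) ⊔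
          (⨆ q ∈ {q : V × ℤ | q.2 ≤ t ∧ q ∉ Y₁ ∧ q ∉ Y₂},
            MeasurableSpace.comap (X q.1 q.2) inferInstance)) =
    mComplete μ
      (⨆ q ∈ {q : V × ℤ | q.2 ≤ t ∧ q ∉ Y₁ ∧ q ∉ Y₂},
        MeasurableSpace.comap (X q.1 q.2) inferInstance)
    := by
  let G : Set (V × ℤ) := {q : V × ℤ | q.2 ≤ t ∧ q ∉ Y₁ ∧ q ∉ Y₂}
  have hG : ∀ q ∈ G, q.2 ≤ t := fun q hq => hq.1
  refine le_antisymm ?_ (le_inf (mComplete_mono μ le_sup_right) (mComplete_mono μ le_sup_right))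
  have hI₁ : ∀ q ∈ (Y₁ : Set (V × ℤ)) ∪ G, q.2 ≤ t := fun q hq => hq.elim (hY₁ q) (hG q)
  have hI₂ : ∀ q ∈ (Y₂ : Set (V × ℤ)) ∪ G, q.2 ≤ t := fun q hq => hq.elim (hY₂ q) (hG q)
  have hm₁ := iSup_comap_eq_comap_coords X hI₁
  have hm₂ := iSup_comap_eq_comap_coords X hI₂
  rw [iSup_union] at hm₁ hm₂
  intro S hS
  obtain ⟨hS₁, hS₂⟩ := MeasurableSpace.measurableSet_inf.1 hS
  obtain ⟨A₁, hA₁, hSA₁⟩ := measurableSet_mComplete_iff.1 hS₁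
  obtain ⟨A₂, hA₂, hSA₂⟩ := measurableSet_mComplete_iff.1 hS₂
  obtain ⟨D₁, hD₁, rfl⟩ := (hm₁ ▸ hA₁ : MeasurableSet[MeasurableSpace.comap _ _] A₁)
  obtain ⟨D₂, hD₂, rfl⟩ := (hm₂ ▸ hA₂ : MeasurableSet[MeasurableSpace.comap _ _] A₂)
  obtain ⟨νv, hσ, hne, hν⟩ := hP.exists_hasReferenceMeasure hXmeas
  let N : Set (ℤ → V → ℝ) :=
    {h | coords (Y₁ ∪ G) h ∈ D₁ ↔ coords (Y₂ ∪ G) h ∈ D₂}ᶜ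
  have hN : MeasurableSet N :=
    (MeasurableSet.iff (measurable_coords _ hD₁) (measurable_coords _ hD₂)).compl
  have hpast : ∀ᵐ ω ∂μ, pastTraj X t ω ∉ N := by
    filter_upwards [(hSA₁.symm.trans hSA₂).mem_iff] with ω hω
    exact not_not.2 hω
  obtain ⟨z, hz⟩ := hν.exists_overwrite hXmeas Y₂ hY₂ hN hpast
  have hdisj' : Disjoint ((Y₁ : Set (V × ℤ)) ∪ G) Y₂ :=
    Set.disjoint_union_left.2
      ⟨Finset.disjoint_coe.2 hdisj, Set.disjoint_left.2 fun q hq => hq.2.2⟩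
  refine measurableSet_mComplete_iff.2
    ⟨_, measurable_coords_overwrite X (Y := Y₂) hG z hD₂, hSA₁.trans ?_⟩
  rw [eventuallyEq_set]
  filter_upwards [hz] with ω hω
  have hiff := not_not.1 hω
  rwa [Set.mem_ofPred_eq, coords_overwrite_of_disjoint hdisj'] at hiff

end GraphicalTS
end
end

section
/- Let G=(V,E) be a mixed graph and let A, B, S be pairwise disjoint subsets of V. Then A and B are p-separated given S in G if and only if A and B are p-separated given S in the marginal ancestral graph G_[an(A∪B∪S)]. -/
open MeasureTheory ProbabilityTheory Filter

noncomputable section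

namespace GraphicalTS

/-! ### σ-algebras, conditional independence, Granger causality -/

variable {Ω : Type*}

/-! ### Connecting paths as reachability of states -/

/-- `G.edge k v w`: the graph has an edge between `v` and `w` which is of kind `k` when
traversed from `v` to `w`. -/
def MixedGraph.edge {V : Type*} (G : MixedGraph V) : EdgeKind → V → V → Prop
  | .fwd, v, w => G.dir v w
  | .bwd, v, w => G.dir w v
  | .un, v, w => G.undir v w

/-- A vertex entered by an edge of kind `k` and left by one of kind `l` is a p-collider. -/
def EdgeKind.collides (k l : EdgeKind) : Prop :=
  k ≠ .bwd ∧ l ≠ .fwd ∧ ¬(k = .un ∧ l = .un)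

/-- A path which entered `v` by an edge of kind `k` (`none` at the start of the path) may leave
it by an edge of kind `l` without being p-blocked by `S` at `v`. -/
def Passable {V : Type*} (S : Set V) : Option EdgeKind → EdgeKind → V → Prop
  | none, _, _ => True
  | some k, l, v => (k.collides l → v ∈ S) ∧ (¬k.collides l → v ∉ S)

/-- `Reaches G S a v k`: some p-connecting path given `S` leads from `a` to `v`, its last edge
being of kind `k` (`none` for the path without edges). -/
inductive Reaches {V : Type*} (G : MixedGraph V) (S : Set V) (a : V) :
    V → Option EdgeKind → Prop
  | refl : Reaches G S a a none
  | step {v w : V} {k : Option EdgeKind} {l : EdgeKind} :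
      Reaches G S a v k → Passable S k l v → G.edge l v w → Reaches G S a w (some l)

/-- `UndirOutside G W v w`: a nonempty undirected path leads from `v` to `w`, all of its
intermediate vertices lying outside `W`. -/
inductive UndirOutside {V : Type*} (G : MixedGraph V) (W : Set V) (v : V) : V → Prop
  | single {w : V} : G.undir v w → UndirOutside G W v w
  | snoc {x w : V} : UndirOutside G W v x → x ∉ W → G.undir x w → UndirOutside G W v w

namespace MGPath

variable {V : Type*} {G : MixedGraph V} {a b : V}

lemma edge (p : MGPath G a b) {i : ℕ} (hi : i < p.n) :
    G.edge (p.kind i) (p.vert i) (p.vert (i + 1)) := by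
  obtain ⟨h₁, h₂, h₃⟩ := p.valid i hi
  cases hk : p.kind i
  exacts [h₁ hk, h₂ hk, h₃ hk]

/-- The path without edges. -/
def nil (G : MixedGraph V) (a : V) : MGPath G a a where
  n := 0
  vert _ := a
  kind _ := .un
  src := rfl
  tgt := rfl
  valid i hi := absurd hi (Nat.not_lt_zero i)

/-- Append an edge to a path. -/
def snoc (p : MGPath G a b) {c : V} (k : EdgeKind) (h : G.edge k b c) : MGPath G a c where
  n := p.n + 1
  vert i := if i ≤ p.n then p.vert i else c
  kind i := if i < p.n then p.kind i else k
  src := by simp [p.src]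
  tgt := by simp
  valid i hi := by
    rcases Nat.lt_succ_iff_lt_or_eq.mp hi with h' | rfl
    · have h'' : i + 1 ≤ p.n := h'
      simpa [h', h'.le, h''] using p.valid i h'
    · simp only [le_refl, if_true, lt_irrefl, if_false, p.tgt, Nat.not_succ_le_self]
      refine ⟨?_, ?_, ?_⟩ <;> rintro rfl <;> exact h

@[simp] lemma snoc_n (p : MGPath G a b) {c : V} (k : EdgeKind) (h : G.edge k b c) :
    (p.snoc k h).n = p.n + 1 := rfl

lemma snoc_vert (p : MGPath G a b) {c : V} (k : EdgeKind) (h : G.edge k b c) {i : ℕ}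
    (hi : i ≤ p.n) : (p.snoc k h).vert i = p.vert i := if_pos hi

lemma snoc_kind (p : MGPath G a b) {c : V} (k : EdgeKind) (h : G.edge k b c) {i : ℕ}
    (hi : i < p.n) : (p.snoc k h).kind i = p.kind i := if_pos hi

@[simp] lemma snoc_kind_last (p : MGPath G a b) {c : V} (k : EdgeKind) (h : G.edge k b c) :
    (p.snoc k h).kind p.n = k := if_neg (lt_irrefl _)

lemma undirected.snoc {p : MGPath G a b} (hp : p.undirected) {c : V} (h : G.edge .un b c) :
    (p.snoc .un h).undirected := by
  intro i hi
  rcases Nat.lt_succ_iff_lt_or_eq.mp hi with hi' | rfl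
  · rw [snoc_kind _ _ _ hi', hp i hi']
  · exact snoc_kind_last ..

/-- The kind of the last edge of a path, `none` if there is no edge. -/
def lastKind (p : MGPath G a b) : Option EdgeKind :=
  if p.n = 0 then none else some (p.kind (p.n - 1))

lemma pConnecting.reaches {p : MGPath G a b} {S : Set V} (hp : p.pConnecting S) :
    ∃ k, Reaches G S a b k := by
  suffices h : ∀ i ≤ p.n,
      Reaches G S a (p.vert i) (if i = 0 then none else some (p.kind (i - 1))) by
    exact ⟨_, p.tgt ▸ h p.n le_rfl⟩
  intro i
  induction i with
  | zero => intro _; simpa [p.src] using Reaches.refl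
  | succ i ih =>
    intro hi
    refine (ih (Nat.le_of_succ_le hi)).step ?_ (p.edge hi)
    split_ifs with h0
    · trivial
    · exact hp i (Nat.pos_of_ne_zero h0) hi

lemma pConnecting.snoc {p : MGPath G a b} {S : Set V} (hp : p.pConnecting S) {c : V}
    {k : EdgeKind} (hk : Passable S p.lastKind k b) (h : G.edge k b c) :
    (p.snoc k h).pConnecting S := by
  intro j hj hjn
  change Passable S (some ((p.snoc k h).kind (j - 1))) ((p.snoc k h).kind j) _
  rcases Nat.lt_succ_iff_lt_or_eq.mp hjn with hj' | rfl
  · rw [snoc_kind _ _ _ (by omega), snoc_kind _ _ _ hj', snoc_vert _ _ _ hj'.le]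
    exact hp j hj hj'
  · rw [snoc_kind _ _ _ (by omega), snoc_kind_last, snoc_vert _ _ _ le_rfl, p.tgt]
    simpa [lastKind, hj.ne'] using hk

end MGPath

section

variable {V : Type*} {G : MixedGraph V} {S W : Set V} {a : V}

lemma Reaches.exists_path {v : V} {k : Option EdgeKind} (h : Reaches G S a v k) :
    ∃ p : MGPath G a v, p.pConnecting S ∧ p.lastKind = k := by
  induction h with
  | refl => exact ⟨MGPath.nil G a, fun j _ hj => absurd hj (Nat.not_lt_zero j), rfl⟩
  | step _ hk he ih =>
    obtain ⟨p, hp, rfl⟩ := ih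
    exact ⟨p.snoc _ he, hp.snoc hk he, by simp [MGPath.lastKind]⟩

lemma pSeparated_iff_not_reaches {A B : Set V} :
    pSeparated G A B S ↔ ∀ a ∈ A, ∀ b ∈ B, ∀ k, ¬Reaches G S a b k := by
  refine forall₄_congr fun a _ b _ => ⟨fun h k hk => ?_, fun h p hp => ?_⟩
  · obtain ⟨p, hp, -⟩ := hk.exists_path
    exact h p hp
  · obtain ⟨k, hk⟩ := hp.reaches
    exact h k hk

namespace UndirOutside

lemma cons {v x w : V} (hv : G.undir v x) (hx : x ∉ W) (h : UndirOutside G W x w) :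
    UndirOutside G W v w := by
  induction h with
  | single h => exact .snoc (.single hv) hx h
  | snoc _ hy h ih => exact .snoc ih hy h

lemma symm {v w : V} (h : UndirOutside G W v w) : UndirOutside G W w v := by
  induction h with
  | single h => exact .single (G.undir_symm _ _ h)
  | snoc _ hx h ih => exact ih.cons (G.undir_symm _ _ h) hx

lemma exists_path {v w : V} (h : UndirOutside G W v w) :
    ∃ p : MGPath G v w, 0 < p.n ∧ p.undirected ∧ ∀ j, 0 < j → j < p.n → p.vert j ∉ W := by
  induction h with
  | single h =>
    exact ⟨(MGPath.nil G v).snoc .un h, Nat.succ_pos _,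
      MGPath.undirected.snoc (fun i hi => absurd hi (Nat.not_lt_zero i)) h,
      fun j hj hj' => absurd (Nat.lt_succ_iff.mp hj') (Nat.not_le.mpr hj)⟩
  | snoc _ hx h ih =>
    obtain ⟨p, -, hp, hW⟩ := ih
    replace h : G.edge .un _ _ := h
    refine ⟨p.snoc .un h, Nat.succ_pos _, hp.snoc h, fun j hj hjn => ?_⟩
    rw [MGPath.snoc_vert _ _ _ (Nat.lt_succ_iff.mp hjn)]
    rcases Nat.lt_succ_iff_lt_or_eq.mp hjn with hj' | rfl
    · exact hW j hj hj'
    · rwa [p.tgt]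

lemma of_undirAvoiding {v w : V} (h : undirAvoiding G W v w) :
    UndirOutside G (G.anc W) v w := by
  obtain ⟨p, hn, hp, hW⟩ := h
  have hedge : ∀ i < p.n, G.undir (p.vert i) (p.vert (i + 1)) := fun i hi =>
    (p.valid i hi).2.2 (hp i hi)
  have key : ∀ i < p.n,
      UndirOutside G (G.anc W) v w ∨ UndirOutside G (G.anc W) v (p.vert (i + 1)) := by
    intro i
    induction i with
    | zero =>
      intro hi
      have := hedge 0 hi
      rw [p.src] at this
      exact .inr (.single this)
    | succ i ih =>
      intro hi
      rcases ih (Nat.lt_of_succ_lt hi) with h | h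
      · exact .inl h
      by_cases hw : p.vert (i + 1) = w
      · exact .inl (hw ▸ h)
      by_cases hv : p.vert (i + 1) = v
      · have := hedge _ hi
        rw [hv] at this
        exact .inr (.single this)
      · exact .inr (h.snoc (fun hA => hW _ i.succ_pos hi ⟨hA, by simp [hv, hw]⟩) (hedge _ hi))
  have := key (p.n - 1) (by omega)
  rwa [Nat.sub_add_cancel hn, p.tgt, or_self] at this

end UndirOutside

lemma MixedGraph.subset_anc (G : MixedGraph V) (W : Set V) : W ⊆ G.anc W :=
  fun w hw => ⟨w, hw, .refl⟩

lemma MixedGraph.anc_anc (G : MixedGraph V) (W : Set V) : G.anc (G.anc W) = G.anc W := by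
  refine Set.Subset.antisymm ?_ (G.subset_anc _)
  rintro u ⟨v, ⟨w, hw, hvw⟩, huv⟩
  exact ⟨w, hw, huv.trans hvw⟩

lemma MixedGraph.mem_of_dir (hW : G.anc W = W) {u v : V} (h : G.dir u v) (hv : v ∈ W) :
    u ∈ W :=
  hW ▸ ⟨v, hv, .single h⟩

lemma marginalGraph_undir_iff (hW : G.anc W = W) {u v : V} :
    (marginalGraph G W).undir u v ↔ u ∈ W ∧ v ∈ W ∧ UndirOutside G W u v := by
  constructor
  · rintro (⟨h, hu, hv⟩ | ⟨hu, hv, h | h⟩)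
    · exact ⟨hu, hv, .single h⟩
    · exact ⟨hu, hv, hW ▸ UndirOutside.of_undirAvoiding h⟩
    · exact ⟨hu, hv, (hW ▸ UndirOutside.of_undirAvoiding h : UndirOutside G W v u).symm⟩
  · rintro ⟨hu, hv, h⟩
    obtain ⟨p, hn, hp, hp'⟩ := h.exists_path
    exact .inr ⟨hu, hv, .inl ⟨p, hn, hp, fun j hj hjn hj' => hp' j hj hjn (hW ▸ hj'.1)⟩⟩

lemma Reaches.append_undirOutside (hSW : S ⊆ W) {v w : V} {k : Option EdgeKind}
    (h : Reaches G S a v k) (hk : Passable S k .un v) (hvw : UndirOutside G W v w) :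
    Reaches G S a w (some .un) := by
  induction hvw with
  | single he => exact h.step hk he
  | snoc _ hx he ih =>
    exact ih.step ⟨fun hc => absurd ⟨rfl, rfl⟩ hc.2.2, fun _ hxS => hx (hSW hxS)⟩ he

lemma Reaches.of_marginalGraph (hW : G.anc W = W) (hSW : S ⊆ W) {v : V}
    {k : Option EdgeKind} (h : Reaches (marginalGraph G W) S a v k) : Reaches G S a v k := by
  induction h with
  | refl => exact .refl
  | @step v w k l _ hk he ih =>
    cases l with
    | fwd => exact ih.step hk he.1
    | bwd => exact ih.step hk he.1
    | un => exact ih.append_undirOutside hSW hk ((marginalGraph_undir_iff hW).mp he).2.2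

/-- A vertex outside an ancestral set `W ⊇ S` can only be reached by an undirected path that
leaves `W` after a connecting path in the marginal graph, or by an edge pointing to it. -/
lemma Reaches.marginalGraph_aux (hW : G.anc W = W) (hSW : S ⊆ W) (ha : a ∈ W) {v : V}
    {k : Option EdgeKind} (h : Reaches G S a v k) :
    (v ∈ W ∧ Reaches (marginalGraph G W) S a v k) ∨ (v ∉ W ∧ (k = some .fwd ∨
      k = some .un ∧ ∃ u l, u ∈ W ∧ Reaches (marginalGraph G W) S a u l ∧
        Passable S l .un u ∧ UndirOutside G W u v)) := by
  induction h with
  | refl => exact .inl ⟨ha, .refl⟩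
  | @step v w k l _ hk he ih =>
    by_cases hw : w ∈ W
    · refine .inl ⟨hw, ?_⟩
      rcases ih with ⟨hv, ih⟩ | ⟨hv, ih⟩
      · cases l with
        | fwd => exact ih.step hk ⟨he, hv, hw⟩
        | bwd => exact ih.step hk ⟨he, hw, hv⟩
        | un => exact ih.step hk ((marginalGraph_undir_iff hW).mpr ⟨hv, hw, .single he⟩)
      · cases l with
        | fwd => exact absurd (G.mem_of_dir hW he hw) hv
        | bwd =>
          rcases ih with rfl | ⟨rfl, -⟩ <;>
            exact absurd (hSW (hk.1 (by simp [EdgeKind.collides]))) hv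
        | un =>
          rcases ih with rfl | ⟨rfl, u, l, hu, hr, hl, huv⟩
          · exact absurd (hSW (hk.1 (by simp [EdgeKind.collides]))) hv
          · exact hr.step hl ((marginalGraph_undir_iff hW).mpr ⟨hu, hw, huv.snoc hv he⟩)
    · refine .inr ⟨hw, ?_⟩
      cases l with
      | fwd => exact .inl rfl
      | bwd =>
        rcases ih with ⟨hv, -⟩ | ⟨hv, rfl | ⟨rfl, -⟩⟩
        · exact absurd (G.mem_of_dir hW he hv) hw
        all_goals exact absurd (hSW (hk.1 (by simp [EdgeKind.collides]))) hv
      | un =>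
        refine .inr ⟨rfl, ?_⟩
        rcases ih with ⟨hv, ih⟩ | ⟨hv, rfl | ⟨rfl, u, l, hu, hr, hl, huv⟩⟩
        · exact ⟨v, k, hv, ih, hk, .single he⟩
        · exact absurd (hSW (hk.1 (by simp [EdgeKind.collides]))) hv
        · exact ⟨u, l, hu, hr, hl, huv.snoc hv he⟩

lemma reaches_marginalGraph_iff (hW : G.anc W = W) (hSW : S ⊆ W) (ha : a ∈ W) {b : V}
    (hb : b ∈ W) {k : Option EdgeKind} :
    Reaches (marginalGraph G W) S a b k ↔ Reaches G S a b k := by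
  refine ⟨.of_marginalGraph hW hSW, fun h => ?_⟩
  rcases h.marginalGraph_aux hW hSW ha with h | h
  exacts [h.2, absurd hb h.1]

end

/-- Lemma: p-separation and marginal ancestral graphs. For a mixed
graph `G` and pairwise disjoint `A, B, S ⊆ V`: `A` and `B` are p-separated given `S`
in `G` iff they are p-separated given `S` in the marginal ancestral graph
`G_[an(A∪B∪S)]`. -/
theorem pSeparation_marginal_ancestral
    {V : Type*} (G : MixedGraph V) (A B S : Set V)
    (hAB : Disjoint A B) (hAS : Disjoint A S) (hBS : Disjoint B S) :
    pSeparated G A B S ↔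
      pSeparated (marginalGraph G (G.anc (A ∪ B ∪ S))) A B S := by
  have hsub := G.subset_anc (A ∪ B ∪ S)
  rw [pSeparated_iff_not_reaches, pSeparated_iff_not_reaches]
  exact forall₅_congr fun a ha b hb k => not_congr (reaches_marginalGraph_iff (G.anc_anc _)
    (fun s hs => hsub (.inr hs)) (hsub (.inl (.inl ha))) (hsub (.inl (.inr hb)))).symm

end GraphicalTS
end
end

section
/- Suppose the process X_V satisfies the block-recursive Granger-causal Markov property (BC) with respect to a mixed graph G=(V,E), and let U⊆V. Then the subprocess X_{an(U)} satisfies the block-recursive Granger-causal Markov property with respect to the marginal ancestral graph G_[an(U)] (Markov properties of the subprocess being taken with respect to the filtration ℱ_{an(U)} generated by X_{an(U)}). -/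
open MeasureTheory ProbabilityTheory Filter

noncomputable section

namespace GraphicalTS

/-! ### σ-algebras, conditional independence, Granger causality -/

variable {Ω : Type*}

namespace MixedGraph

variable {V : Type*} {G : MixedGraph V}

lemma subset_anc_s17 (A : Set V) : A ⊆ G.anc A :=
  fun a ha => ⟨a, ha, Relation.ReflTransGen.refl⟩

lemma anc_anc_s17 (A : Set V) : G.anc (G.anc A) = G.anc A := by
  refine Set.Subset.antisymm ?_ (subset_anc_s17 _)
  rintro c ⟨b, ⟨a, ha, hba⟩, hcb⟩
  exact ⟨a, ha, Relation.ReflTransGen.trans hcb hba⟩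

lemma pa_subset_anc {U A : Set V} (hA : A ⊆ G.anc U) : G.pa A ⊆ G.anc U := by
  rintro v ⟨⟨a, ha, hva⟩, -⟩
  obtain ⟨u, hu, hau⟩ := hA ha
  exact ⟨u, hu, Relation.ReflTransGen.head hva hau⟩

lemma pa_anc (U : Set V) : G.pa (G.anc U) = ∅ :=
  Set.eq_empty_of_forall_notMem fun _ hv => hv.2 (pa_subset_anc subset_rfl hv)

lemma pa_marginalGraph_anc {U A : Set V} (hA : A ⊆ G.anc U) :
    (marginalGraph G (G.anc U)).pa A = G.pa A := by
  ext v
  constructor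
  · rintro ⟨⟨a, ha, h⟩, hv⟩
    exact ⟨⟨a, ha, h.1⟩, hv⟩
  · intro h
    obtain ⟨⟨a, ha, hva⟩, hv⟩ := id h
    exact ⟨⟨a, ha, hva, pa_subset_anc hA h, hA ha⟩, hv⟩

lemma nb_marginalGraph_subset (W A : Set V) : (marginalGraph G W).nb A ⊆ W := by
  rintro v ⟨⟨a, -, h | h⟩, -⟩
  exacts [h.2.1, h.1]

/-- The vertices reachable from `A` by undirected paths all of whose vertices after the
first one lie outside `W`. -/
def undirClosure (G : MixedGraph V) (W A : Set V) : Set V :=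
  {v | ∃ a ∈ A, Relation.ReflTransGen (fun x y => G.undir x y ∧ y ∉ W) a v}

lemma subset_undirClosure (W A : Set V) : A ⊆ G.undirClosure W A :=
  fun a ha => ⟨a, ha, Relation.ReflTransGen.refl⟩

lemma undirClosure_inter_subset (W A : Set V) : G.undirClosure W A ∩ W ⊆ A := by
  rintro v ⟨⟨a, ha, h⟩, hv⟩
  rcases Relation.ReflTransGen.cases_tail h with rfl | ⟨_, -, h⟩
  exacts [ha, absurd hv h.2]

lemma exists_undirected_path {W : Set V} {a c v : V}
    (hac : Relation.ReflTransGen (fun x y => G.undir x y ∧ y ∉ W) a c) (hcv : G.undir c v) :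
    ∃ p : MGPath G a v, 0 < p.n ∧ p.undirected ∧ ∀ j, 0 < j → j < p.n → p.vert j ∉ W := by
  induction hac using Relation.ReflTransGen.head_induction_on with
  | refl =>
    refine ⟨⟨1, fun i => Nat.casesOn i c fun _ => v, fun _ => EdgeKind.un, rfl, rfl, ?_⟩,
      one_pos, fun _ _ => rfl, fun j h0 h1 => by simp only at h1; omega⟩
    intro i hi
    obtain rfl : i = 0 := by omega
    simpa using hcv
  | @head a b hab _ ih =>
    obtain ⟨p, -, hp, hpW⟩ := ih
    refine ⟨⟨p.n + 1, fun i => Nat.casesOn i a p.vert, fun _ => EdgeKind.un, rfl, p.tgt, ?_⟩,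
      Nat.succ_pos _, fun _ _ => rfl, ?_⟩
    · rintro (_ | i) hi
      · simpa [p.src] using hab.1
      · have hi' : i < p.n := by omega
        simpa using (p.valid i hi').2.2 (hp i hi')
    · rintro (_ | _ | j) h0 hj
      · omega
      · simpa [p.src] using hab.2
      · exact hpW (j + 1) (by omega) (by simp only at hj; omega)

lemma nb_undirClosure_subset {U A : Set V} (hA : A ⊆ G.anc U) :
    G.nb (G.undirClosure (G.anc U) A) ⊆ (marginalGraph G (G.anc U)).nb A := by
  rintro v ⟨⟨c, ⟨a, ha, hac⟩, hvc⟩, hv⟩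
  have hcv := G.undir_symm _ _ hvc
  have hvU : v ∈ G.anc U := by
    by_contra h
    exact hv ⟨a, ha, hac.tail ⟨hcv, h⟩⟩
  obtain ⟨p, hn, hp, hpU⟩ := exists_undirected_path hac hcv
  refine ⟨⟨a, ha, Or.inr ⟨hvU, hA ha, Or.inr ⟨p, hn, hp, fun j h0 hj h => hpU j h0 hj ?_⟩⟩⟩,
    fun h => hv (subset_undirClosure _ _ h)⟩
  simpa only [anc_anc_s17] using h.1

end MixedGraph

section CondIndep

lemma condExp_ae_eq_of_le_of_le {m₁ m₂ m₃ : MeasurableSpace Ω} [m0 : MeasurableSpace Ω]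
    {μ : Measure Ω} [IsFiniteMeasure μ] (h₁₂ : m₁ ≤ m₂) (h₂₃ : m₂ ≤ m₃) (h₃ : m₃ ≤ m0) {f : Ω → ℝ} (h : μ[f|m₃] =ᵐ[μ] μ[f|m₁]) :
    μ[f|m₂] =ᵐ[μ] μ[f|m₁] := by
  have h₂ := h₂₃.trans h₃
  calc μ[f|m₂] =ᵐ[μ] μ[μ[f|m₃]|m₂] := (condExp_condExp_of_le h₂₃ h₃).symm
    _ =ᵐ[μ] μ[μ[f|m₁]|m₂] := condExp_congr_ae h
    _ = μ[f|m₁] := condExp_of_stronglyMeasurable h₂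
      (stronglyMeasurable_condExp.mono h₁₂) integrable_condExp

lemma CondIndepSigma.mono {m₁ m₂ m₃ n₁ n₂ n₃ : MeasurableSpace Ω} [m0 : MeasurableSpace Ω]
    {μ : Measure Ω} [IsFiniteMeasure μ]
    (h : CondIndepSigma μ m₁ m₂ m₃) (hm : m₂ ⊔ m₃ ≤ m0) (h₁ : n₁ ≤ m₁)
    (h₃ : m₃ ≤ n₃) (h₂ : n₂ ⊔ n₃ ≤ m₂ ⊔ m₃) : CondIndepSigma μ n₁ n₂ n₃ := fun s hs =>
  (condExp_ae_eq_of_le_of_le (h₃.trans le_sup_right) h₂ hm (h s (h₁ s hs))).trans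
    (condExp_ae_eq_of_le_of_le h₃ (le_sup_right.trans h₂) hm (h s (h₁ s hs))).symm

lemma generateFrom_inter_eq_sup (m₁ m₂ : MeasurableSpace Ω) :
    MeasurableSpace.generateFrom
      {s | ∃ a b, MeasurableSet[m₁] a ∧ MeasurableSet[m₂] b ∧ a ∩ b = s} = m₁ ⊔ m₂ := by
  apply le_antisymm
  · refine MeasurableSpace.generateFrom_le ?_
    rintro _ ⟨a, b, ha, hb, rfl⟩
    exact MeasurableSet.inter ((le_sup_left : m₁ ≤ m₁ ⊔ m₂) a ha)
      ((le_sup_right : m₂ ≤ m₁ ⊔ m₂) b hb)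
  · refine sup_le (fun a ha => ?_) (fun b hb => ?_)
    · exact MeasurableSpace.measurableSet_generateFrom
        ⟨a, Set.univ, ha, @MeasurableSet.univ _ m₂, Set.inter_univ a⟩
    · exact MeasurableSpace.measurableSet_generateFrom
        ⟨Set.univ, b, @MeasurableSet.univ _ m₁, hb, Set.univ_inter b⟩

lemma isPiSystem_inter (m₁ m₂ : MeasurableSpace Ω) :
    IsPiSystem {s : Set Ω | ∃ a b, MeasurableSet[m₁] a ∧ MeasurableSet[m₂] b ∧ a ∩ b = s} := by
  rintro _ ⟨a, b, ha, hb, rfl⟩ _ ⟨c, d, hc, hd, rfl⟩ -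
  exact ⟨a ∩ c, b ∩ d, ha.inter hc, hb.inter hd, Set.inter_inter_inter_comm _ _ _ _⟩

/-- To identify a conditional expectation given `m₁ ⊔ m₂` it suffices to test on
intersections of sets from the two `σ`-algebras. -/
lemma ae_eq_condExp_sup {m₁ m₂ : MeasurableSpace Ω} [m0 : MeasurableSpace Ω]
    {μ : Measure Ω} [IsFiniteMeasure μ] (hm : m₁ ⊔ m₂ ≤ m0)
    {f g : Ω → ℝ} (hf : Integrable f μ) (hg : Integrable g μ)
    (hgm : StronglyMeasurable[m₁ ⊔ m₂] g)
    (h : ∀ a b, MeasurableSet[m₁] a → MeasurableSet[m₂] b →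
      ∫ x in a ∩ b, g x ∂μ = ∫ x in a ∩ b, f x ∂μ) :
    g =ᵐ[μ] μ[f|m₁ ⊔ m₂] := by
  refine ae_eq_condExp_of_forall_setIntegral_eq hm hf (fun _ _ _ => hg.integrableOn) ?_
    hgm.aestronglyMeasurable
  intro s hs _
  induction s, hs using MeasurableSpace.induction_on_inter
    (generateFrom_inter_eq_sup m₁ m₂).symm (isPiSystem_inter m₁ m₂) with
  | empty => simp
  | basic s hs =>
    obtain ⟨a, b, ha, hb, rfl⟩ := hs
    exact h a b ha hb
  | compl s hs ih =>
    have huniv := h Set.univ Set.univ (@MeasurableSet.univ _ m₁) (@MeasurableSet.univ _ m₂)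
    simp only [Set.inter_univ, setIntegral_univ] at huniv
    rw [setIntegral_compl (hm s hs) hg, setIntegral_compl (hm s hs) hf, huniv,
      ih (measure_lt_top _ _)]
  | iUnion s hd hs ih =>
    rw [integral_iUnion (fun i => hm _ (hs i)) hd hg.integrableOn,
      integral_iUnion (fun i => hm _ (hs i)) hd hf.integrableOn]
    exact tsum_congr fun i => ih i (measure_lt_top _ _)

lemma setIntegral_mul_condExp {m : MeasurableSpace Ω} [m0 : MeasurableSpace Ω]
    {μ : Measure Ω} [IsFiniteMeasure μ] (hm : m ≤ m0)
    {f g : Ω → ℝ} (hf : StronglyMeasurable[m] f) (hfg : Integrable (f * g) μ)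
    (hg : Integrable g μ) {s : Set Ω} (hs : MeasurableSet[m] s) :
    ∫ x in s, (f * g) x ∂μ = ∫ x in s, (f * μ[g|m]) x ∂μ := by
  rw [← setIntegral_condExp hm hfg hs]
  exact integral_congr_ae (ae_restrict_of_ae (condExp_mul_of_stronglyMeasurable_left hf hfg hg))

lemma CondIndepSigma.symm {m₁ m₂ m₃ : MeasurableSpace Ω} [m0 : MeasurableSpace Ω]
    {μ : Measure Ω} [IsFiniteMeasure μ]
    (h : CondIndepSigma μ m₁ m₂ m₃) (h₁ : m₁ ≤ m0) (h₂ : m₂ ≤ m0) (h₃ : m₃ ≤ m0) :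
    CondIndepSigma μ m₂ m₁ m₃ := by
  intro H hH
  have hint : ∀ {s : Set Ω}, MeasurableSet s → Integrable (s.indicator fun _ => (1 : ℝ)) μ :=
    fun hs => (integrable_const 1).indicator hs
  have hmul : ∀ (s : Set Ω) (f : Ω → ℝ), f * (s.indicator fun _ => (1 : ℝ)) = s.indicator f := by
    intro s f
    ext x
    by_cases hx : x ∈ s <;> simp [hx]
  refine (ae_eq_condExp_sup (sup_le h₁ h₃) (hint (h₂ H hH)) integrable_condExp
    (stronglyMeasurable_condExp.mono le_sup_right) ?_).symm
  intro A K hA hK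
  set a := A.indicator fun _ => (1 : ℝ) with ha
  set b := H.indicator fun _ => (1 : ℝ) with hb
  have hA0 := h₁ A hA
  have hH0 := h₂ H hH
  have hHK : MeasurableSet[m₂ ⊔ m₃] (K ∩ H) :=
    MeasurableSet.inter ((le_sup_right : m₃ ≤ m₂ ⊔ m₃) K hK) ((le_sup_left : m₂ ≤ m₂ ⊔ m₃) H hH)
  calc ∫ x in A ∩ K, (μ[b|m₃]) x ∂μ
      = ∫ x in K, (μ[b|m₃] * a) x ∂μ := by
        rw [hmul, setIntegral_indicator hA0, Set.inter_comm]
    _ = ∫ x in K, (μ[b|m₃] * μ[a|m₃]) x ∂μ :=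
        setIntegral_mul_condExp h₃ stronglyMeasurable_condExp
          (by rw [hmul]; exact integrable_condExp.indicator hA0) (hint hA0) hK
    _ = ∫ x in K, (μ[a|m₃] * b) x ∂μ := by
        rw [mul_comm]
        exact (setIntegral_mul_condExp h₃ stronglyMeasurable_condExp
          (by rw [hmul]; exact integrable_condExp.indicator hH0) (hint hH0) hK).symm
    _ = ∫ x in K ∩ H, (μ[a|m₃]) x ∂μ := by rw [hmul, setIntegral_indicator hH0]
    _ = ∫ x in K ∩ H, (μ[a|m₂ ⊔ m₃]) x ∂μ :=
        integral_congr_ae (ae_restrict_of_ae (h A hA).symm)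
    _ = ∫ x in K ∩ H, a x ∂μ := setIntegral_condExp (sup_le h₂ h₃) (hint hA0) hHK
    _ = ∫ x in A ∩ K, b x ∂μ := by
        rw [ha, hb, setIntegral_indicator hA0, setIntegral_indicator hH0]
        congr 2
        ext x
        simp only [Set.mem_inter_iff]
        tauto

/-- The contraction property of conditional independence. -/
lemma CondIndepSigma.contraction {m₁ m₂ m₃ m₄ n : MeasurableSpace Ω} [m0 : MeasurableSpace Ω]
    {μ : Measure Ω} [IsFiniteMeasure μ]
    (h : CondIndepSigma μ m₁ m₂ n) (h' : CondIndepSigma μ m₁ m₄ m₃) (hn : m₄ ⊔ m₃ = n)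
    (hm : m₂ ⊔ n ≤ m0) : CondIndepSigma μ m₁ m₂ m₃ := by
  have hn3 : m₃ ≤ n := hn ▸ le_sup_right
  intro s hs
  refine condExp_ae_eq_of_le_of_le le_sup_right (sup_le_sup_left hn3 _) hm ((h s hs).trans ?_)
  rw [← hn]
  exact h' s hs

lemma condIndepSigma_of_not_le {m₁ m₂ m₃ : MeasurableSpace Ω} [m0 : MeasurableSpace Ω]
    {μ : Measure Ω} (h : ¬m₃ ≤ m0) : CondIndepSigma μ m₁ m₂ m₃ := fun s _ => by
  rw [condExp_of_not_le h, condExp_of_not_le fun h' => h (le_sup_right.trans h')]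

variable {V : Type*} [m0 : MeasurableSpace Ω] {μ : Measure Ω} {X : V → ℤ → Ω → ℝ}

lemma pastSigma_mono (μ : Measure Ω) (X : V → ℤ → Ω → ℝ) {A B : Set V} {s t : ℤ}
    (hAB : A ⊆ B) (hst : s ≤ t) : pastSigma μ X A s ≤ pastSigma μ X B t := by
  refine sup_le_sup_right (iSup₂_le fun a ha => iSup₂_le fun r hr => ?_) _
  refine le_trans ?_ (le_biSup _ (hAB ha))
  exact le_iSup₂ (f := fun r (_ : r ≤ t) => MeasurableSpace.comap (X a r) inferInstance)
    r (hr.trans hst)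

lemma pastSigma_union (μ : Measure Ω) (X : V → ℤ → Ω → ℝ) (A B : Set V) (t : ℤ) :
    pastSigma μ X (A ∪ B) t = pastSigma μ X A t ⊔ pastSigma μ X B t := by
  simp only [pastSigma, mComplete]
  rw [iSup_union, sup_sup_distrib_right]

lemma pastSigma_le [μ.IsComplete] (hX : ∀ v t, Measurable (X v t)) (A : Set V) (t : ℤ) :
    pastSigma μ X A t ≤ m0 :=
  sup_le (iSup₂_le fun a _ => iSup₂_le fun r _ => (hX a r).comap_le)
    (MeasurableSpace.generateFrom_le fun _ hs => measurableSet_of_null hs)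

lemma not_pastSigma_le (hμ : ¬μ.IsComplete) (A : Set V) (t : ℤ) : ¬pastSigma μ X A t ≤ m0 :=
  fun h => hμ ⟨fun s hs => h s ((le_sup_right : _ ≤ pastSigma μ X A t) s
    (MeasurableSpace.measurableSet_generateFrom hs))⟩

lemma blockRecursiveMarkov_of_not_isComplete (hμ : ¬μ.IsComplete) (G : MixedGraph V)
    (W : Set V) : BlockRecursiveMarkov μ X G W := fun _ _ =>
  ⟨fun _ => condIndepSigma_of_not_le (not_pastSigma_le hμ _ _),
    fun _ => condIndepSigma_of_not_le fun h => not_pastSigma_le hμ _ _ (le_sup_left.trans h)⟩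

end CondIndep

/-- Lemma: inheritance of the block-recursive Markov property by
marginal ancestral graphs. If `X_V` satisfies (BC) w.r.t. `G` and `U ⊆ V`, then the
subprocess `X_{an(U)}` satisfies (BC) w.r.t. the marginal ancestral graph `G_[an(U)]`,
the Markov property being taken w.r.t. the filtration generated by `X_{an(U)}`. -/
theorem blockRecursive_marginal_ancestral
    {V Ω : Type*} [MeasurableSpace Ω]
    (μ : Measure Ω) [IsProbabilityMeasure μ]
    (X : V → ℤ → Ω → ℝ) (hXmeas : ∀ v t, Measurable (X v t))
    (G : MixedGraph V) (hBC : BlockRecursiveMarkov μ X G Set.univ)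
    (U : Set V) :
    BlockRecursiveMarkov μ X (marginalGraph G (G.anc U)) (G.anc U) := by
  by_cases hμ : μ.IsComplete
  swap
  · exact blockRecursiveMarkov_of_not_isComplete hμ _ _
  have hle : ∀ A t, pastSigma μ X A t ≤ ‹MeasurableSpace Ω› := pastSigma_le hXmeas
  set W := G.anc U with hW
  intro A hA
  refine ⟨fun t => ?_, fun t => ?_⟩
  · rw [MixedGraph.pa_marginalGraph_anc hA,
      Set.sdiff_sdiff_cancel_left (Set.union_subset (MixedGraph.pa_subset_anc hA) hA)]
    have h := (hBC A (Set.subset_univ A)).1 t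
    rw [Set.sdiff_sdiff_cancel_left (Set.subset_univ _)] at h
    exact h.mono (sup_le (hle _ _) (hle _ _)) le_rfl le_rfl
      (sup_le_sup_right
        (pastSigma_mono μ X (Set.sdiff_subset_sdiff_left (Set.subset_univ _)) le_rfl) _)
  · set N := (marginalGraph G W).nb A with hN
    set C := G.undirClosure W A with hC
    set B := W \ (N ∪ A) with hB
    have hNW : N ⊆ W := MixedGraph.nb_marginalGraph_subset W A
    have hNA : Disjoint N A := Set.disjoint_sdiff_left
    have hAC : A ⊆ C := MixedGraph.subset_undirClosure W A
    have hCW : C ∩ W ⊆ A := MixedGraph.undirClosure_inter_subset W A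
    have hNC : G.nb C ⊆ N := MixedGraph.nb_undirClosure_subset hA
    have hrest : W \ (B ∪ A) = N := by
      ext v
      have h₁ := @hNW v
      have h₂ : v ∈ N → v ∉ A := fun h => Set.disjoint_left.mp hNA h
      simp only [hB, Set.mem_sdiff, Set.mem_union]
      tauto
    have hBsub : B ⊆ Set.univ \ (G.nb C ∪ C) := by
      rintro v ⟨hvW, hv⟩
      refine ⟨trivial, ?_⟩
      rintro (h | h)
      exacts [hv (Or.inl (hNC h)), hv (Or.inr (hCW ⟨h, hvW⟩))]
    have hNsub : N ⊆ (Set.univ \ (G.nb C ∪ C)) ∪ G.nb C := by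
      intro v hv
      have h : v ∉ C := fun h => Set.disjoint_left.mp hNA hv (hCW ⟨h, hNW hv⟩)
      by_cases h' : v ∈ G.nb C
      exacts [Or.inr h', Or.inl ⟨trivial, fun h'' => h''.elim h' h⟩]
    have hcompl : Set.univ \ (Set.univ \ (G.nb C ∪ C) ∪ C) = G.nb C := by
      ext v
      have h : v ∈ G.nb C → v ∉ C := fun h => h.2
      simp only [Set.mem_sdiff, Set.mem_union, Set.mem_univ, true_and]
      tauto
    rw [hrest]
    have hcontemp := (hBC C (Set.subset_univ C)).2 t
    rw [hcompl] at hcontemp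
    have hgranger := (hBC W (Set.subset_univ W)).1 t
    rw [hW, MixedGraph.pa_anc, ← hW, Set.empty_union,
      Set.sdiff_sdiff_cancel_left (Set.subset_univ _)] at hgranger
    have hV : pastSigma μ X (Set.univ \ W) t ⊔ pastSigma μ X W t = pastSigma μ X Set.univ t := by
      rw [← pastSigma_union, Set.sdiff_union_of_subset (Set.subset_univ W)]
    have hNle : pastSigma μ X N (t + 1) ≤
        pastSigma μ X (Set.univ \ (G.nb C ∪ C)) (t + 1) ⊔ pastSigma μ X (G.nb C) (t + 1) := by
      rw [← pastSigma_union]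
      exact pastSigma_mono μ X hNsub le_rfl
    have hfull : CondIndepSigma μ (pastSigma μ X B (t + 1)) (pastSigma μ X A (t + 1))
        (pastSigma μ X Set.univ t ⊔ pastSigma μ X N (t + 1)) := by
      refine ((hcontemp.symm (hle _ _) (hle _ _) (sup_le (hle _ _) (hle _ _))).mono
        (sup_le (hle _ _) (sup_le (hle _ _) (hle _ _))) (pastSigma_mono μ X hAC le_rfl)
        (sup_le_sup_left (pastSigma_mono μ X hNC le_rfl) _) ?_).symm (hle _ _) (hle _ _)
        (sup_le (hle _ _) (hle _ _))
      refine sup_le ((pastSigma_mono μ X hBsub le_rfl).trans le_sup_left) (sup_le ?_ ?_)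
      · exact le_sup_left.trans le_sup_right
      · exact hNle.trans (sup_le_sup_left le_sup_right _)
    have hpast : CondIndepSigma μ (pastSigma μ X B (t + 1)) (pastSigma μ X (Set.univ \ W) t)
        (pastSigma μ X W t ⊔ pastSigma μ X N (t + 1)) := by
      refine ((hgranger.symm (hle _ _) (hle _ _) (hle _ _)).mono
        (sup_le (hle _ _) (hle _ _)) le_rfl le_sup_left ?_).symm (hle _ _) (hle _ _)
        (sup_le (hle _ _) (hle _ _))
      exact sup_le ((pastSigma_mono μ X Set.sdiff_subset le_rfl).trans le_sup_left)
        (sup_le le_sup_right ((pastSigma_mono μ X hNW le_rfl).trans le_sup_left))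
    exact hfull.contraction hpast (by rw [← sup_assoc, hV])
      (sup_le (hle _ _) (sup_le (hle _ _) (hle _ _)))

end GraphicalTS
end
end
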